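/- arXiv:1503.04826 — 2 statements merged into one kernel-verified Lean document; each statement's English description precedes it below -/
import Mathlib

section
/- (HWI-type inequality on bounded densities.) Fix R > 0. There exists a constant C = C(R,d,p,q) > 0 such that for all μ, ν ∈ P_2(ℝ^d) that are absolutely continuous with respect to Lebesgue measure with densities bounded by R, and for every coupling γ of μ and ν (a probability measure on ℝ^d×ℝ^d with first marginal μ and second marginal ν) with transport cost c(γ) = ∬ |x−y|² dγ(x,y), one has |E(μ) − E(ν)| ≤ 2 ‖(∇K)*μ‖_{L²(μ)} √(c(γ)) + C ω(c(γ)), where ω is the log-Lipschitz modulus of convexity. -/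
open MeasureTheory Filter
open scoped ENNReal Topology NNReal

noncomputable section

/-- Power-law interaction kernel `K(x) = |x|^q/q - |x|^p/p` (real-valued). -/
noncomputable def Kfun (d : ℕ) (p q : ℝ) (x : EuclideanSpace ℝ (Fin d)) : ℝ :=
  ‖x‖ ^ q / q - ‖x‖ ^ p / p

/-- Power-law interaction kernel, valued in `[0,∞]` (note `K 0 = ∞` when `p < 0 < q`). -/
noncomputable def KE (d : ℕ) (p q : ℝ) (x : EuclideanSpace ℝ (Fin d)) : ℝ≥0∞ :=
  (‖x‖₊ : ℝ≥0∞) ^ q / ENNReal.ofReal q + (‖x‖₊ : ℝ≥0∞) ^ p / ENNReal.ofReal (-p)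

/-- Repulsive part `K^r(x) = -|x|^p/p` of the power-law kernel, valued in `[0,∞]`. -/
noncomputable def KrE (d : ℕ) (p : ℝ) (x : EuclideanSpace ℝ (Fin d)) : ℝ≥0∞ :=
  (‖x‖₊ : ℝ≥0∞) ^ p / ENNReal.ofReal (-p)

/-- Rescaled mollifier `φ_ε(x) = ε^{-d} φ(x/ε)`. -/
noncomputable def scaled (d : ℕ) (φ : EuclideanSpace ℝ (Fin d) → ℝ) (ε : ℝ)
    (x : EuclideanSpace ℝ (Fin d)) : ℝ :=
  (ε ^ d)⁻¹ * φ (ε⁻¹ • x)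

/-- Mollifier hypotheses (M1)–(M3). -/
def IsMollifier (d : ℕ) (φ : EuclideanSpace ℝ (Fin d) → ℝ) : Prop :=
  ContDiff ℝ (⊤ : ℕ∞) φ ∧ (∀ x y, ‖x‖ = ‖y‖ → φ x = φ y) ∧ (∀ x, 0 ≤ φ x) ∧
    (∫ x, φ x) = 1 ∧
    ∃ C : ℝ, 0 < C ∧ ∃ l : ℝ, max (2 * (d : ℝ) + 1) 4 ≤ l ∧
      ∀ x : EuclideanSpace ℝ (Fin d), x ≠ 0 → φ x ≤ C * ‖x‖ ^ (-l)

/-- Regularized kernel `K_ε = φ_ε * K * φ_ε` (real-valued). -/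
noncomputable def Kreg (d : ℕ) (p q : ℝ) (φ : EuclideanSpace ℝ (Fin d) → ℝ) (ε : ℝ)
    (x : EuclideanSpace ℝ (Fin d)) : ℝ :=
  ∫ y, ∫ z, scaled d φ ε y * Kfun d p q (x - y - z) * scaled d φ ε z

/-- Double mollification `g * K * g` of a `[0,∞]`-valued kernel by a nonnegative function. -/
noncomputable def convE (d : ℕ) (g : EuclideanSpace ℝ (Fin d) → ℝ)
    (K : EuclideanSpace ℝ (Fin d) → ℝ≥0∞) (x : EuclideanSpace ℝ (Fin d)) : ℝ≥0∞ :=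
  ∫⁻ y, ∫⁻ z, ENNReal.ofReal (g y) * K (x - y - z) * ENNReal.ofReal (g z)

/-- Interaction energy `E(μ) = ∬ K(x-y) dμ(x) dμ(y)` for a `[0,∞]`-valued kernel. -/
noncomputable def energyE (d : ℕ) (K : EuclideanSpace ℝ (Fin d) → ℝ≥0∞)
    (μ : Measure (EuclideanSpace ℝ (Fin d))) : ℝ≥0∞ :=
  ∫⁻ x, ∫⁻ y, K (x - y) ∂μ ∂μ

/-- Regularized interaction energy `E_ε(μ) = ∬ K_ε(x-y) dμ(x) dμ(y)`. -/
noncomputable def energyReg (d : ℕ) (p q : ℝ) (φ : EuclideanSpace ℝ (Fin d) → ℝ) (ε : ℝ)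
    (μ : Measure (EuclideanSpace ℝ (Fin d))) : ℝ≥0∞ :=
  energyE d (fun x => ENNReal.ofReal (Kreg d p q φ ε x)) μ

/-- Real-valued interaction energy. -/
noncomputable def energyReal (d : ℕ) (p q : ℝ) (μ : Measure (EuclideanSpace ℝ (Fin d))) : ℝ :=
  ∫ x, ∫ y, Kfun d p q (x - y) ∂μ ∂μ

/-- Borel probability measure with finite second moment. -/
def IsP2 (d : ℕ) (μ : Measure (EuclideanSpace ℝ (Fin d))) : Prop :=
  IsProbabilityMeasure μ ∧ (∫⁻ x, (‖x‖₊ : ℝ≥0∞) ^ 2 ∂μ) < ⊤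

/-- The heat kernel `ψ_ε(x) = (4πε)^{-d/2} e^{-|x|²/(4ε)}`. -/
noncomputable def heat (d : ℕ) (ε : ℝ) (x : EuclideanSpace ℝ (Fin d)) : ℝ :=
  (4 * Real.pi * ε) ^ (-(d : ℝ) / 2) * Real.exp (-‖x‖ ^ 2 / (4 * ε))

/-- Weak-* convergence of a sequence of measures: convergence of integrals of all bounded
continuous functions. -/
def WeakStarTendsto (d : ℕ) (μ : ℕ → Measure (EuclideanSpace ℝ (Fin d)))
    (ν : Measure (EuclideanSpace ℝ (Fin d))) : Prop :=
  ∀ f : EuclideanSpace ℝ (Fin d) → ℝ, Continuous f → (∃ M : ℝ, ∀ x, |f x| ≤ M) →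
    Tendsto (fun k => ∫ x, f x ∂(μ k)) atTop (𝓝 (∫ x, f x ∂ν))

/-- `μ` is absolutely continuous (w.r.t. Lebesgue) with density bounded by `R`. -/
def HasBddDensity (d : ℕ) (μ : Measure (EuclideanSpace ℝ (Fin d))) (R : ℝ) : Prop :=
  ∃ ρ : EuclideanSpace ℝ (Fin d) → ℝ≥0∞, Measurable ρ ∧ μ = volume.withDensity ρ ∧
    ∀ᵐ x ∂(volume : Measure (EuclideanSpace ℝ (Fin d))), ρ x ≤ ENNReal.ofReal R

/-- Explicit gradient `∇K(x) = x|x|^{q-2} - x|x|^{p-2}` of the power-law kernel. -/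
noncomputable def gradK (d : ℕ) (p q : ℝ) (x : EuclideanSpace ℝ (Fin d)) :
    EuclideanSpace ℝ (Fin d) :=
  (‖x‖ ^ (q - 2)) • x - (‖x‖ ^ (p - 2)) • x

/-- The log-Lipschitz modulus of convexity `ω`. -/
noncomputable def omegaMod (x : ℝ) : ℝ :=
  if x ≤ Real.exp (-1 - Real.sqrt 2) then x * |Real.log x|
  else Real.sqrt (x ^ 2 + 2 * (1 + Real.sqrt 2) * Real.exp (-1 - Real.sqrt 2) * x)

/-- Support of a measure: points all of whose neighborhoods have positive measure. -/
def msupport (d : ℕ) (μ : Measure (EuclideanSpace ℝ (Fin d))) :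
    Set (EuclideanSpace ℝ (Fin d)) :=
  {x | ∀ r : ℝ, 0 < r → 0 < μ (Metric.ball x r)}

/-- The measure `μ * ψ_δ` obtained by mollifying `μ` with the heat kernel at scale `δ`. -/
noncomputable def heatMollified (d : ℕ) (μ : Measure (EuclideanSpace ℝ (Fin d))) (δ : ℝ) :
    Measure (EuclideanSpace ℝ (Fin d)) :=
  volume.withDensity fun x => ENNReal.ofReal (∫ y, heat d δ (x - y) ∂μ)

def Gr (d : ℕ) (ε t : ℝ) : ℝ := 1 + if t < 1 then t ^ (1 - (d : ℝ)) / max t ε else 0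

lemma Gr_ge_one (d : ℕ) {ε t : ℝ} (hε : 0 < ε) (ht : 0 ≤ t) : 1 ≤ Gr d ε t := by
  unfold Gr
  split_ifs
  · have : 0 ≤ t ^ (1 - (d : ℝ)) / max t ε := by positivity
    linarith
  · simp

/-- `t^{r-1} ≤ max(t,ε) G(t)`. -/
lemma pow_sub_one_le (d : ℕ) {r ε t : ℝ} (hr1 : 2 - (d : ℝ) ≤ r) (hr2 : r ≤ 2)
    (hε : 0 < ε) (ht : 0 < t) : t ^ (r - 1) ≤ max t ε * Gr d ε t := by
  have hm : 0 < max t ε := lt_max_of_lt_left ht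
  by_cases h1 : t < 1
  · have h2 : t ^ (r - 1) ≤ t ^ (1 - (d : ℝ)) :=
      Real.rpow_le_rpow_of_exponent_ge ht h1.le (by linarith)
    unfold Gr
    rw [if_pos h1, mul_add, mul_div_cancel₀ _ hm.ne']
    linarith
  · push Not at h1
    have h2 : t ^ (r - 1) ≤ t ^ (1 : ℝ) :=
      Real.rpow_le_rpow_of_exponent_le h1 (by linarith)
    rw [Real.rpow_one] at h2
    have := Gr_ge_one d hε ht.le
    nlinarith [le_max_left t ε]

lemma pow_sub_two_mul_le (d : ℕ) {r ε t : ℝ} (hr1 : 2 - (d : ℝ) ≤ r) (hr2 : r ≤ 2)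
    (hε : 0 < ε) (ht : 0 ≤ t) : t ^ (r - 2) * t ≤ max t ε * Gr d ε t := by
  rcases ht.eq_or_lt with rfl | ht
  · have := Gr_ge_one d hε le_rfl
    simp only [mul_zero]
    have : 0 < max 0 ε := lt_max_of_lt_right hε
    positivity
  · have := pow_sub_one_le d hr1 hr2 hε ht
    rwa [show r - 1 = r - 2 + 1 by ring, Real.rpow_add_one ht.ne'] at this

lemma pow_le (d : ℕ) {r ε t : ℝ} (hr1 : 2 - (d : ℝ) ≤ r) (hr2 : r ≤ 2) (hr0 : r ≠ 0)
    (hε : 0 < ε) (ht : 0 ≤ t) : t ^ r ≤ max t ε ^ 2 * Gr d ε t := by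
  rcases ht.eq_or_lt with rfl | ht
  · have := Gr_ge_one d hε le_rfl
    rw [Real.zero_rpow hr0]
    positivity
  · have := pow_sub_one_le d hr1 hr2 hε ht
    rw [show r = r - 1 + 1 by ring, Real.rpow_add_one ht.ne']
    have hG := Gr_ge_one d hε ht.le
    have := le_max_left t ε
    calc t ^ (r - 1) * t ≤ (max t ε * Gr d ε t) * max t ε := by gcongr
      _ = _ := by ring

/-- One dimensional Taylor estimate. -/
lemma taylor_rpow (ρ : ℝ) : ∃ C : ℝ, 0 < C ∧ ∀ w : ℝ, 1 / 4 ≤ w → w ≤ 9 / 4 →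
    |w ^ ρ - 1 - ρ * (w - 1)| ≤ C * (w - 1) ^ 2 := by
  have hcont : ContinuousOn (fun w : ℝ => ρ * ((ρ - 1) * w ^ (ρ - 2))) (Set.Icc (1/4) (9/4)) := by
    refine continuousOn_const.mul (continuousOn_const.mul ?_)
    exact continuousOn_id.rpow_const (fun x hx => Or.inl (by
      have := hx.1; simp only [id]; linarith))
  obtain ⟨M, hM⟩ := isCompact_Icc.exists_bound_of_continuousOn hcont
  have hM0 : 0 ≤ M := (norm_nonneg _).trans (hM 1 (by constructor <;> norm_num))
  refine ⟨M + 1, by linarith, ?_⟩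
  have h1mem : (1 : ℝ) ∈ Set.Icc (1/4 : ℝ) (9/4) := by constructor <;> norm_num
  have hd1 : ∀ w ∈ Set.Icc (1/4 : ℝ) (9/4), |ρ * w ^ (ρ - 1) - ρ| ≤ M * |w - 1| := by
    intro w hw
    have := (convex_Icc (1/4 : ℝ) (9/4)).norm_image_sub_le_of_norm_hasDerivWithin_le
      (f := fun w : ℝ => ρ * w ^ (ρ - 1)) (f' := fun w : ℝ => ρ * ((ρ - 1) * w ^ (ρ - 2)))
      (C := M) (fun x hx => by
        have hx0 : x ≠ 0 := by have := hx.1; linarith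
        have := (Real.hasDerivAt_rpow_const (x := x) (p := ρ - 1) (Or.inl hx0)).const_mul ρ
        rw [show ρ - 1 - 1 = ρ - 2 by ring] at this
        exact this.hasDerivWithinAt) hM h1mem hw
    simpa [Real.norm_eq_abs] using this
  intro w hw1 hw2
  have hsub : Set.uIcc 1 w ⊆ Set.Icc (1/4 : ℝ) (9/4) :=
    Set.uIcc_subset_Icc h1mem ⟨hw1, hw2⟩
  have := (convex_uIcc (1 : ℝ) w).norm_image_sub_le_of_norm_hasDerivWithin_le
      (f := fun w : ℝ => w ^ ρ - 1 - ρ * (w - 1)) (f' := fun w : ℝ => ρ * w ^ (ρ - 1) - ρ)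
      (C := M * |w - 1|) (fun x hx => by
        have hx0 : x ≠ 0 := by have := (hsub hx).1; linarith
        have h1 := (Real.hasDerivAt_rpow_const (x := x) (p := ρ) (Or.inl hx0)).sub_const 1
        have h2 := ((hasDerivAt_id x).sub_const 1).const_mul ρ
        have := h1.sub h2
        simp only [mul_one] at this
        exact this.hasDerivWithinAt) (fun x hx => by
        refine (hd1 x (hsub hx)).trans ?_
        exact mul_le_mul_of_nonneg_left (Set.abs_sub_left_of_mem_uIcc hx) hM0) Set.left_mem_uIcc Set.right_mem_uIcc
  simp only [Real.one_rpow, sub_self, mul_zero, sub_zero, Real.norm_eq_abs] at this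
  calc _ ≤ _ := this
    _ = M * (w - 1) ^ 2 := by rw [mul_assoc, ← sq, sq_abs]
    _ ≤ _ := by nlinarith [sq_nonneg (w - 1)]

/-- Pointwise second order estimate for a power kernel. -/
lemma taylor_power {F : Type*} [NormedAddCommGroup F] [InnerProductSpace ℝ F] (d : ℕ) {r : ℝ}
    (hr1 : 2 - (d : ℝ) ≤ r) (hr2 : r ≤ 2) (hr0 : r ≠ 0) :
    ∃ C : ℝ, 0 < C ∧ ∀ ε : ℝ, 0 < ε → ∀ a b : F,
      |‖b‖ ^ r / r - ‖a‖ ^ r / r - ‖a‖ ^ (r - 2) * inner ℝ a (b - a)| ≤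
        C * ((‖b - a‖ ^ 2 + ε ^ 2) * (Gr d ε ‖a‖ + Gr d ε ‖b‖)) := by
  obtain ⟨C0, hC0, hT⟩ := taylor_rpow (r / 2)
  have hr : 0 < |r| := abs_pos.mpr hr0
  refine ⟨9 * (1 / |r| + 1) + (9 * C0 / |r| + 1), by positivity, ?_⟩
  intro ε hε a b
  set D := ‖b - a‖ with hD
  have hD0 : 0 ≤ D := norm_nonneg _
  have hGa := Gr_ge_one d hε (norm_nonneg a)
  have hGb := Gr_ge_one d hε (norm_nonneg b)
  have hba : ‖b‖ ≤ ‖a‖ + D := by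
    have := norm_add_le a (b - a); simpa using this
  have hab : ‖a‖ ≤ ‖b‖ + D := by
    have := norm_sub_le b (b - a); simpa using this
  have hX : 0 ≤ (D ^ 2 + ε ^ 2) * (Gr d ε ‖a‖ + Gr d ε ‖b‖) := by positivity
  have hinner : |inner ℝ a (b - a)| ≤ ‖a‖ * D := abs_real_inner_le_norm _ _
  by_cases hc : ‖a‖ ≤ 2 * D
  · set m := max (3 * D) ε with hm
    have hm0 : 0 < m := lt_max_of_lt_right hε
    have hma : max ‖a‖ ε ≤ m := max_le_max (by linarith) le_rfl
    have hmb : max ‖b‖ ε ≤ m := max_le_max (by linarith) le_rfl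
    have hDm : D ≤ m := le_trans (by linarith) (le_max_left _ _)
    have hm2 : m ^ 2 ≤ 9 * (D ^ 2 + ε ^ 2) := by
      rcases max_cases (3 * D) ε with h | h <;> rw [hm, h.1] <;> nlinarith
    have h1 : ‖a‖ ^ r ≤ m ^ 2 * Gr d ε ‖a‖ :=
      (pow_le d hr1 hr2 hr0 hε (norm_nonneg a)).trans (by gcongr)
    have h2 : ‖b‖ ^ r ≤ m ^ 2 * Gr d ε ‖b‖ :=
      (pow_le d hr1 hr2 hr0 hε (norm_nonneg b)).trans (by gcongr)
    have h3 : ‖a‖ ^ (r - 2) * ‖a‖ ≤ m * Gr d ε ‖a‖ :=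
      (pow_sub_two_mul_le d hr1 hr2 hε (norm_nonneg a)).trans (by gcongr)
    have h4 : |‖a‖ ^ (r - 2) * inner ℝ a (b - a)| ≤ m ^ 2 * Gr d ε ‖a‖ := by
      rw [abs_mul, abs_of_nonneg (Real.rpow_nonneg (norm_nonneg a) _)]
      calc ‖a‖ ^ (r - 2) * |inner ℝ a (b - a)| ≤ ‖a‖ ^ (r - 2) * (‖a‖ * D) := by gcongr
        _ = (‖a‖ ^ (r - 2) * ‖a‖) * D := by ring
        _ ≤ (m * Gr d ε ‖a‖) * m := by gcongr
        _ = _ := by ring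
    have h5 : |‖a‖ ^ r / r| ≤ (1 / |r|) * (m ^ 2 * Gr d ε ‖a‖) := by
      rw [abs_div, abs_of_nonneg (Real.rpow_nonneg (norm_nonneg a) _), div_eq_inv_mul, ← one_div]
      gcongr
    have h6 : |‖b‖ ^ r / r| ≤ (1 / |r|) * (m ^ 2 * Gr d ε ‖b‖) := by
      rw [abs_div, abs_of_nonneg (Real.rpow_nonneg (norm_nonneg b) _), div_eq_inv_mul, ← one_div]
      gcongr
    calc _ ≤ |‖b‖ ^ r / r| + |‖a‖ ^ r / r| + |‖a‖ ^ (r - 2) * inner ℝ a (b - a)| :=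
          (abs_sub _ _).trans (add_le_add (abs_sub _ _) le_rfl)
      _ ≤ (1 / |r|) * (m ^ 2 * Gr d ε ‖b‖) + (1 / |r|) * (m ^ 2 * Gr d ε ‖a‖)
            + m ^ 2 * (Gr d ε ‖a‖ + Gr d ε ‖b‖) := by
          have : 0 ≤ m ^ 2 * Gr d ε ‖b‖ := by positivity
          linarith
      _ = (1 / |r| + 1) * (m ^ 2 * (Gr d ε ‖a‖ + Gr d ε ‖b‖)) := by ring
      _ ≤ (1 / |r| + 1) * ((9 * (D ^ 2 + ε ^ 2)) * (Gr d ε ‖a‖ + Gr d ε ‖b‖)) := by gcongr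
      _ = (9 * (1 / |r| + 1)) * ((D ^ 2 + ε ^ 2) * (Gr d ε ‖a‖ + Gr d ε ‖b‖)) := by ring
      _ ≤ _ := by
          refine mul_le_mul_of_nonneg_right ?_ hX
          have : 0 ≤ 9 * C0 / |r| + 1 := by positivity
          linarith
  · push Not at hc
    have ha : 0 < ‖a‖ := by linarith
    set δ := D / ‖a‖ with hδ
    have hδ0 : 0 ≤ δ := by positivity
    have hδ1 : δ ≤ 1 / 2 := by rw [hδ, div_le_iff₀ ha]; linarith
    set τ := ‖b‖ / ‖a‖ with hτ
    have hτ1 : 1 / 2 ≤ τ := by rw [hτ, le_div_iff₀ ha]; linarith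
    have hτ2 : τ ≤ 3 / 2 := by rw [hτ, div_le_iff₀ ha]; linarith
    set σ := inner ℝ a (b - a) / ‖a‖ ^ 2 with hσ
    have hσ1 : |σ| ≤ δ := by
      rw [hσ, abs_div, abs_of_pos (by positivity : 0 < ‖a‖ ^ 2), div_le_iff₀ (by positivity), hδ]
      calc _ ≤ _ := hinner
        _ = _ := by field_simp
    have hw : τ ^ 2 - 1 = 2 * σ + δ ^ 2 := by
      have h := norm_add_sq_real a (b - a)
      rw [add_sub_cancel] at h
      rw [hτ, hσ, hδ, div_pow, h]
      field_simp
      ring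
    have hbr : ‖b‖ ^ r = ‖a‖ ^ r * (τ ^ 2) ^ (r / 2) := by
      rw [← Real.rpow_natCast_mul (by linarith : 0 ≤ τ), hτ,
        show ((2 : ℕ) : ℝ) * (r / 2) = r by push_cast; ring, Real.div_rpow (norm_nonneg _) ha.le]
      have := (Real.rpow_pos_of_pos ha r).ne'
      field_simp
    have har : ‖a‖ ^ (r - 2) = ‖a‖ ^ r / ‖a‖ ^ 2 := by
      rw [Real.rpow_sub ha]; norm_num
    have hTw := hT (τ ^ 2) (by
      have : (1 / 2 : ℝ) ^ 2 ≤ τ ^ 2 := by gcongr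
      linarith) (by
      have : τ ^ 2 ≤ (3 / 2 : ℝ) ^ 2 := by gcongr
      linarith)
    have hkey : ‖b‖ ^ r / r - ‖a‖ ^ r / r - ‖a‖ ^ (r - 2) * inner ℝ a (b - a) =
        ‖a‖ ^ r * (((τ ^ 2) ^ (r / 2) - 1 - r / 2 * (τ ^ 2 - 1)) / r + δ ^ 2 / 2) := by
      have h1 : ‖a‖ ^ (r - 2) * inner ℝ a (b - a) = ‖a‖ ^ r * σ := by
        rw [har, hσ]; ring
      rw [h1, hbr, hw]
      field_simp
      ring
    have hw3 : (τ ^ 2 - 1) ^ 2 ≤ 9 * δ ^ 2 := by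
      rw [hw]
      have h1 := abs_le.mp hσ1
      have h2 : |2 * σ + δ ^ 2| ≤ |3 * δ| := by
        rw [abs_of_nonneg (by positivity : 0 ≤ 3 * δ), abs_le]
        have h3 : δ ^ 2 ≤ δ := by
          rw [sq]; exact mul_le_of_le_one_left hδ0 (by linarith)
        have h4 : 0 ≤ δ ^ 2 := sq_nonneg δ
        constructor
        · linarith [h1.1]
        · linarith [h1.2]
      have := sq_le_sq.mpr h2
      calc _ ≤ _ := this
        _ = _ := by ring
    have hpow := pow_le d hr1 hr2 hr0 hε ha.le
    have hmax : max ‖a‖ ε ^ 2 * δ ^ 2 ≤ D ^ 2 + ε ^ 2 := by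
      rcases max_cases ‖a‖ ε with h | h <;> rw [h.1]
      · have : ‖a‖ * δ = D := by rw [hδ]; field_simp
        rw [← mul_pow, this]
        linarith [sq_nonneg ε]
      · have h5 : δ ^ 2 ≤ 1 := pow_le_one₀ hδ0 (by linarith)
        have h6 : ε ^ 2 * δ ^ 2 ≤ ε ^ 2 * 1 := by gcongr
        linarith [sq_nonneg D]
    rw [hkey, abs_mul, abs_of_pos (Real.rpow_pos_of_pos ha r)]
    calc _ ≤ ‖a‖ ^ r * (C0 * (9 * δ ^ 2) / |r| + δ ^ 2) := by
          gcongr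
          refine (abs_add_le _ _).trans ?_
          rw [abs_div, abs_of_nonneg (by positivity : 0 ≤ δ ^ 2 / 2)]
          gcongr
          · exact hTw.trans (by gcongr)
          · linarith [sq_nonneg δ]
      _ = (9 * C0 / |r| + 1) * (‖a‖ ^ r * δ ^ 2) := by ring
      _ ≤ (9 * C0 / |r| + 1) * ((max ‖a‖ ε ^ 2 * Gr d ε ‖a‖) * δ ^ 2) := by gcongr
      _ = (9 * C0 / |r| + 1) * ((max ‖a‖ ε ^ 2 * δ ^ 2) * Gr d ε ‖a‖) := by ring
      _ ≤ (9 * C0 / |r| + 1) * ((D ^ 2 + ε ^ 2) * (Gr d ε ‖a‖ + Gr d ε ‖b‖)) := by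
          gcongr
          linarith
      _ ≤ _ := by
          refine mul_le_mul_of_nonneg_right ?_ hX
          have : 0 ≤ 9 * (1 / |r| + 1) := by positivity
          linarith

lemma Gr_measurable (d : ℕ) (ε : ℝ) : Measurable (Gr d ε) := by
  unfold Gr
  refine measurable_const.add (Measurable.ite measurableSet_Iio ?_ measurable_const)
  fun_prop

lemma int_inv_max {ε : ℝ} (hε : 0 < ε) (hε1 : ε ≤ 1) :
    ∫ y in Set.Ioo (0 : ℝ) 1, 1 / max y ε = 1 - Real.log ε := by
  rw [← integral_Ioc_eq_integral_Ioo, ← intervalIntegral.integral_of_le zero_le_one]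
  have hc : Continuous fun y : ℝ => 1 / max y ε := by
    refine continuous_const.div (by fun_prop) (fun y => ?_)
    exact (lt_max_of_lt_right hε).ne'
  rw [← intervalIntegral.integral_add_adjacent_intervals (hc.intervalIntegrable 0 ε)
    (hc.intervalIntegrable ε 1)]
  have h1 : ∫ y in (0 : ℝ)..ε, 1 / max y ε = ∫ y in (0 : ℝ)..ε, 1 / ε := by
    refine intervalIntegral.integral_congr fun y hy => ?_
    rw [Set.uIcc_of_le hε.le] at hy
    rw [max_eq_right hy.2]
  have h2 : ∫ y in ε..1, 1 / max y ε = ∫ y in ε..1, 1 / y := by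
    refine intervalIntegral.integral_congr fun y hy => ?_
    rw [Set.uIcc_of_le hε1] at hy
    rw [max_eq_left hy.1]
  rw [h1, h2, integral_one_div_of_pos hε zero_lt_one]
  simp [hε.ne']
  ring

lemma lintegral_Gr_sub_one (d : ℕ) (hd : 3 ≤ d) {ε : ℝ} (hε : 0 < ε) (hε1 : ε ≤ 1) :
    ∫⁻ x : EuclideanSpace ℝ (Fin d), ENNReal.ofReal (Gr d ε ‖x‖ - 1) =
      ENNReal.ofReal (d * (volume.real (Metric.ball (0 : EuclideanSpace ℝ (Fin d)) 1))
        * (1 - Real.log ε)) := by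
  have : Nontrivial (EuclideanSpace ℝ (Fin d)) := by
    have : Nonempty (Fin d) := ⟨⟨0, by omega⟩⟩
    infer_instance
  have hfin : Module.finrank ℝ (EuclideanSpace ℝ (Fin d)) = d := by simp
  have hpt : ∀ y ∈ Set.Ioi (0 : ℝ), y ^ (d - 1) • (Gr d ε y - 1) =
      (Set.Ioo (0 : ℝ) 1).indicator (fun y => 1 / max y ε) y := by
    intro y hy
    have hy : 0 < y := hy
    unfold Gr
    by_cases h : y < 1
    · rw [if_pos h, Set.indicator_of_mem (show y ∈ Set.Ioo (0 : ℝ) 1 from ⟨hy, h⟩),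
        smul_eq_mul, add_sub_cancel_left, ← mul_div_assoc, ← Real.rpow_natCast,
        ← Real.rpow_add hy, Nat.cast_sub (by omega)]
      simp
    · rw [if_neg h, Set.indicator_of_notMem (fun h' => h h'.2)]
      simp
  have hc : Continuous fun y : ℝ => 1 / max y ε := by
    refine continuous_const.div (by fun_prop) (fun y => ?_)
    exact (lt_max_of_lt_right hε).ne'
  have hI : Integrable (fun x : EuclideanSpace ℝ (Fin d) => Gr d ε ‖x‖ - 1) := by
    have := integrable_fun_norm_addHaar (volume : Measure (EuclideanSpace ℝ (Fin d)))
      (f := fun t => Gr d ε t - 1)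
    rw [this, hfin, integrableOn_congr_fun hpt measurableSet_Ioi]
    refine Integrable.integrableOn ?_
    rw [integrable_indicator_iff measurableSet_Ioo]
    exact (hc.integrableOn_Icc (a := 0) (b := 1)).mono_set Set.Ioo_subset_Icc_self
  rw [← ofReal_integral_eq_lintegral_ofReal hI
    (Eventually.of_forall fun x => by
      have := Gr_ge_one d hε (norm_nonneg x)
      simp only [Pi.zero_apply]; linarith)]
  congr 1
  rw [integral_fun_norm_addHaar (volume : Measure (EuclideanSpace ℝ (Fin d)))
      (fun t => Gr d ε t - 1), hfin, setIntegral_congr_fun measurableSet_Ioi hpt,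
      setIntegral_indicator measurableSet_Ioo,
      Set.inter_eq_self_of_subset_right (fun y hy => hy.1), int_inv_max hε hε1]
  simp only [nsmul_eq_mul, smul_eq_mul]
  ring

/-- Uniform bound for the convolution of `G` with a bounded density. -/
lemma lintegral_Gr_le (d : ℕ) (hd : 3 ≤ d) {R : ℝ} (hR : 0 < R) :
    ∃ A : ℝ, 0 < A ∧ ∀ μ : Measure (EuclideanSpace ℝ (Fin d)), IsProbabilityMeasure μ →
      HasBddDensity d μ R → ∀ ε : ℝ, 0 < ε → ε ≤ 1 → ∀ x,
      ∫⁻ y, ENNReal.ofReal (Gr d ε ‖x - y‖) ∂μ ≤ ENNReal.ofReal (A * (1 - Real.log ε)) := by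
  set B := d * (volume.real (Metric.ball (0 : EuclideanSpace ℝ (Fin d)) 1)) with hB
  have hB0 : 0 ≤ B := by positivity
  refine ⟨1 + R * B, by positivity, ?_⟩
  intro μ hμ hden ε hε hε1 x
  have hlog : Real.log ε ≤ 0 := Real.log_nonpos hε.le hε1
  obtain ⟨ρ, hρm, hρ, hρR⟩ := hden
  have hle : μ ≤ ENNReal.ofReal R • volume := by
    rw [hρ, ← withDensity_const]
    exact withDensity_mono hρR
  have hmeas : Measurable fun y : EuclideanSpace ℝ (Fin d) =>
      ENNReal.ofReal (Gr d ε ‖x - y‖ - 1) := by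
    have := Gr_measurable d ε
    fun_prop
  calc ∫⁻ y, ENNReal.ofReal (Gr d ε ‖x - y‖) ∂μ
      ≤ ∫⁻ y, (1 + ENNReal.ofReal (Gr d ε ‖x - y‖ - 1)) ∂μ := by
        refine lintegral_mono fun y => ?_
        have := Gr_ge_one d hε (norm_nonneg (x - y))
        rw [← ENNReal.ofReal_one, ← ENNReal.ofReal_add zero_le_one (by linarith)]
        exact ENNReal.ofReal_le_ofReal (by linarith)
    _ = 1 + ∫⁻ y, ENNReal.ofReal (Gr d ε ‖x - y‖ - 1) ∂μ := by
        rw [lintegral_add_left measurable_const]; simp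
    _ ≤ 1 + ∫⁻ y, ENNReal.ofReal (Gr d ε ‖x - y‖ - 1) ∂(ENNReal.ofReal R • volume) := by
        gcongr
    _ = 1 + ENNReal.ofReal R * ENNReal.ofReal (B * (1 - Real.log ε)) := by
        rw [lintegral_smul_measure, lintegral_sub_left_eq_self
          (fun z : EuclideanSpace ℝ (Fin d) => ENNReal.ofReal (Gr d ε ‖z‖ - 1)) x,
          lintegral_Gr_sub_one d hd hε hε1, smul_eq_mul]
    _ = ENNReal.ofReal (1 + R * (B * (1 - Real.log ε))) := by
        rw [ENNReal.ofReal_add zero_le_one (by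
          have : 0 ≤ 1 - Real.log ε := by linarith
          positivity), ENNReal.ofReal_one, ENNReal.ofReal_mul hR.le]
    _ ≤ _ := by
        refine ENNReal.ofReal_le_ofReal ?_
        nlinarith

section Double

variable {F : Type*} [NormedAddCommGroup F] [MeasurableSpace F] [BorelSpace F]
  [SecondCountableTopology F]

lemma half_bound (γ : Measure (F × F)) [IsProbabilityMeasure γ] {G : F → ℝ≥0∞}
    (hG : Measurable G) {π : F × F → F} (hπ : Measurable π) {M : ℝ≥0∞}
    (hM : ∀ x, ∫⁻ z, G (x - π z) ∂γ ≤ M) {f : F × F → ℝ≥0∞} (hf : Measurable f) :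
    ∫⁻ w, f w.1 * G (π w.1 - π w.2) ∂(γ.prod γ) ≤ (∫⁻ z, f z ∂γ) * M := by
  rw [lintegral_prod _ (by fun_prop), ← lintegral_mul_const _ hf]
  refine lintegral_mono fun z => ?_
  simp only
  rw [lintegral_const_mul _ (by fun_prop)]
  gcongr
  exact hM _

lemma half_bound' (γ : Measure (F × F)) [IsProbabilityMeasure γ] {G : F → ℝ≥0∞}
    (hG : Measurable G) (hGs : ∀ a, G (-a) = G a) {π : F × F → F} (hπ : Measurable π) {M : ℝ≥0∞}
    (hM : ∀ x, ∫⁻ z, G (x - π z) ∂γ ≤ M) {f : F × F → ℝ≥0∞} (hf : Measurable f) :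
    ∫⁻ w, f w.2 * G (π w.1 - π w.2) ∂(γ.prod γ) ≤ (∫⁻ z, f z ∂γ) * M := by
  rw [← lintegral_prod_swap]
  refine le_trans (le_of_eq ?_) (half_bound γ hG hπ hM hf)
  refine lintegral_congr fun w => ?_
  simp only [Prod.fst_swap, Prod.snd_swap]
  rw [← hGs, neg_sub]

lemma double_bound (γ : Measure (F × F)) [IsProbabilityMeasure γ] {G : F → ℝ≥0∞}
    (hG : Measurable G) (hGs : ∀ a, G (-a) = G a) {M : ℝ≥0∞}
    (hM1 : ∀ x, ∫⁻ z, G (x - z.1) ∂γ ≤ M) (hM2 : ∀ x, ∫⁻ z, G (x - z.2) ∂γ ≤ M)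
    {f : F × F → ℝ≥0∞} (hf : Measurable f) :
    ∫⁻ w, (f w.1 + f w.2) * (G (w.1.1 - w.2.1) + G (w.1.2 - w.2.2)) ∂(γ.prod γ)
      ≤ 4 * ((∫⁻ z, f z ∂γ) * M) := by
  have h1 := half_bound γ hG measurable_fst hM1 hf
  have h2 := half_bound γ hG measurable_snd hM2 hf
  have h3 := half_bound' γ hG hGs measurable_fst hM1 hf
  have h4 := half_bound' γ hG hGs measurable_snd hM2 hf
  calc _ = ∫⁻ w, (f w.1 * G (w.1.1 - w.2.1) + f w.1 * G (w.1.2 - w.2.2))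
            + (f w.2 * G (w.1.1 - w.2.1) + f w.2 * G (w.1.2 - w.2.2)) ∂(γ.prod γ) := by
        refine lintegral_congr fun w => ?_
        ring
    _ = _ := by
        rw [lintegral_add_left (by fun_prop), lintegral_add_left (by fun_prop),
          lintegral_add_left (by fun_prop)]
    _ ≤ ((∫⁻ z, f z ∂γ) * M + (∫⁻ z, f z ∂γ) * M) + ((∫⁻ z, f z ∂γ) * M + (∫⁻ z, f z ∂γ) * M) :=
        add_le_add (add_le_add h1 h2) (add_le_add h3 h4)
    _ = _ := by ring

lemma double_real (γ : Measure (F × F)) [IsProbabilityMeasure γ] {G : F → ℝ}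
    (hG : Measurable G) (hG0 : ∀ a, 0 ≤ G a) (hGs : ∀ a, G (-a) = G a) {M : ℝ} (hM : 0 ≤ M)
    (hM1 : ∀ x, ∫⁻ z, ENNReal.ofReal (G (x - z.1)) ∂γ ≤ ENNReal.ofReal M)
    (hM2 : ∀ x, ∫⁻ z, ENNReal.ofReal (G (x - z.2)) ∂γ ≤ ENNReal.ofReal M)
    {f : F × F → ℝ} (hf : Measurable f) (hf0 : ∀ z, 0 ≤ f z) (hfi : Integrable f γ) :
    Integrable (fun w : (F × F) × (F × F) =>
      (f w.1 + f w.2) * (G (w.1.1 - w.2.1) + G (w.1.2 - w.2.2))) (γ.prod γ) ∧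
    ∫ w, (f w.1 + f w.2) * (G (w.1.1 - w.2.1) + G (w.1.2 - w.2.2)) ∂(γ.prod γ)
      ≤ 4 * ((∫ z, f z ∂γ) * M) := by
  have hb := double_bound γ (G := fun a => ENNReal.ofReal (G a)) (by fun_prop)
    (fun a => by simp only [hGs]) hM1 hM2 (f := fun z => ENNReal.ofReal (f z)) (by fun_prop)
  have hI0 : 0 ≤ ∫ z, f z ∂γ := integral_nonneg hf0
  rw [← ofReal_integral_eq_lintegral_ofReal hfi (Eventually.of_forall hf0),
    ← ENNReal.ofReal_mul hI0, show (4 : ℝ≥0∞) = ENNReal.ofReal 4 by norm_num,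
    ← ENNReal.ofReal_mul (by norm_num)] at hb
  have hnn : ∀ w : (F × F) × (F × F),
      0 ≤ (f w.1 + f w.2) * (G (w.1.1 - w.2.1) + G (w.1.2 - w.2.2)) := fun w =>
    mul_nonneg (add_nonneg (hf0 _) (hf0 _)) (add_nonneg (hG0 _) (hG0 _))
  have heq : ∀ w : (F × F) × (F × F),
      (ENNReal.ofReal (f w.1) + ENNReal.ofReal (f w.2)) *
        (ENNReal.ofReal (G (w.1.1 - w.2.1)) + ENNReal.ofReal (G (w.1.2 - w.2.2))) =
      ENNReal.ofReal ((f w.1 + f w.2) * (G (w.1.1 - w.2.1) + G (w.1.2 - w.2.2))) := fun w => by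
    rw [ENNReal.ofReal_mul (add_nonneg (hf0 _) (hf0 _)), ENNReal.ofReal_add (hf0 _) (hf0 _),
      ENNReal.ofReal_add (hG0 _) (hG0 _)]
  simp only [heq] at hb
  have hmeas : Measurable (fun w : (F × F) × (F × F) =>
      (f w.1 + f w.2) * (G (w.1.1 - w.2.1) + G (w.1.2 - w.2.2))) := by fun_prop
  have hint : Integrable (fun w : (F × F) × (F × F) =>
      (f w.1 + f w.2) * (G (w.1.1 - w.2.1) + G (w.1.2 - w.2.2))) (γ.prod γ) := by
    refine ⟨hmeas.aestronglyMeasurable, ?_⟩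
    rw [hasFiniteIntegral_iff_ofReal (Eventually.of_forall hnn)]
    exact hb.trans_lt ENNReal.ofReal_lt_top
  refine ⟨hint, ?_⟩
  rw [← ofReal_integral_eq_lintegral_ofReal hint (Eventually.of_forall hnn)] at hb
  exact (ENNReal.ofReal_le_ofReal_iff (by positivity)).mp hb

end Double


lemma Kfun_measurable (d : ℕ) (p q : ℝ) : Measurable (Kfun d p q) := by
  unfold Kfun; fun_prop

lemma gradK_measurable (d : ℕ) (p q : ℝ) : Measurable (gradK d p q) := by
  unfold gradK; fun_prop

lemma gradK_neg (d : ℕ) (p q : ℝ) (a : EuclideanSpace ℝ (Fin d)) :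
    gradK d p q (-a) = - gradK d p q a := by
  unfold gradK; simp only [norm_neg, smul_neg]; abel

lemma Kfun_bound (d : ℕ) {p q : ℝ} (hp1 : 2 - (d : ℝ) ≤ p) (hp2 : p < 0)
    (hq1 : 0 < q) (hq2 : q ≤ 2) (a : EuclideanSpace ℝ (Fin d)) :
    |Kfun d p q a| ≤ (1 / q + 1 / |p|) * (max ‖a‖ 1 ^ 2 * Gr d 1 ‖a‖) := by
  have h1 := pow_le d hp1 (by linarith) hp2.ne one_pos (norm_nonneg a)
  have h2 := pow_le d (r := q) (by linarith) hq2 hq1.ne' one_pos (norm_nonneg a)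
  have hp : 0 < |p| := abs_pos.mpr hp2.ne
  unfold Kfun
  refine (abs_sub _ _).trans ?_
  rw [abs_div, abs_div, abs_of_pos hq1, abs_of_nonneg (Real.rpow_nonneg (norm_nonneg a) p),
    abs_of_nonneg (Real.rpow_nonneg (norm_nonneg a) q), add_mul]
  refine add_le_add ?_ ?_
  · rw [div_eq_inv_mul, one_div]; gcongr
  · rw [div_eq_inv_mul, one_div]; gcongr

lemma gradK_bound (d : ℕ) {p q : ℝ} (hp1 : 2 - (d : ℝ) ≤ p) (hp2 : p < 0)
    (hq1 : 0 < q) (hq2 : q ≤ 2) (a : EuclideanSpace ℝ (Fin d)) :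
    ‖gradK d p q a‖ ≤ 2 * (max ‖a‖ 1 * Gr d 1 ‖a‖) := by
  have h1 := pow_sub_two_mul_le d hp1 (by linarith) one_pos (norm_nonneg a)
  have h2 := pow_sub_two_mul_le d (r := q) (by linarith) hq2 one_pos (norm_nonneg a)
  unfold gradK
  refine (norm_sub_le _ _).trans ?_
  rw [norm_smul, norm_smul, Real.norm_of_nonneg (Real.rpow_nonneg (norm_nonneg a) _),
    Real.norm_of_nonneg (Real.rpow_nonneg (norm_nonneg a) _)]
  linarith

lemma max_mul_Gr_le (d : ℕ) {t : ℝ} (ht : 0 ≤ t) : max t 1 * Gr d 1 t ≤ Gr d 1 t + t := by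
  by_cases h : t < 1
  · rw [max_eq_right h.le]; linarith
  · rw [max_eq_left (not_lt.mp h)]
    unfold Gr
    rw [if_neg h]; linarith

/-- Second order estimate for the full kernel. -/
lemma taylor_K (d : ℕ) {p q : ℝ} (hp1 : 2 - (d : ℝ) ≤ p) (hp2 : p < 0)
    (hq1 : 0 < q) (hq2 : q ≤ 2) : ∃ C : ℝ, 0 < C ∧ ∀ ε : ℝ, 0 < ε →
    ∀ a b : EuclideanSpace ℝ (Fin d),
      |Kfun d p q b - Kfun d p q a - inner ℝ (gradK d p q a) (b - a)| ≤
        C * ((‖b - a‖ ^ 2 + ε ^ 2) * (Gr d ε ‖a‖ + Gr d ε ‖b‖)) := by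
  obtain ⟨C1, hC1, h1⟩ := taylor_power (F := EuclideanSpace ℝ (Fin d)) d hp1 (by linarith) hp2.ne
  obtain ⟨C2, hC2, h2⟩ := taylor_power (F := EuclideanSpace ℝ (Fin d)) d (r := q) (by linarith)
    hq2 hq1.ne'
  refine ⟨C2 + C1, by positivity, fun ε hε a b => ?_⟩
  have := (abs_sub _ _).trans (add_le_add (h2 ε hε a b) (h1 ε hε a b))
  rw [← add_mul] at this
  have heq : Kfun d p q b - Kfun d p q a - inner ℝ (gradK d p q a) (b - a) =
      (‖b‖ ^ q / q - ‖a‖ ^ q / q - ‖a‖ ^ (q - 2) * inner ℝ a (b - a)) -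
      (‖b‖ ^ p / p - ‖a‖ ^ p / p - ‖a‖ ^ (p - 2) * inner ℝ a (b - a)) := by
    unfold Kfun gradK
    rw [inner_sub_left, real_inner_smul_left, real_inner_smul_left]
    ring
  rw [heq]
  exact this

lemma omega_bound {c : ℝ} (hc : 0 < c) :
    c * (1 - Real.log (min 1 (Real.sqrt c))) ≤ 3 * omegaMod c := by
  have hs2 : Real.sqrt 2 ≤ 2 := by
    rw [Real.sqrt_le_left (by norm_num)]; norm_num
  have hs0 : 0 ≤ Real.sqrt 2 := Real.sqrt_nonneg 2
  unfold omegaMod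
  have hlogs : Real.log (Real.sqrt c) = Real.log c / 2 := Real.log_sqrt hc.le
  split_ifs with h
  · have hlog : Real.log c ≤ -1 - Real.sqrt 2 := by
      rw [← Real.log_exp (-1 - Real.sqrt 2)]
      exact Real.log_le_log hc h
    have hc1 : c ≤ 1 := by
      refine h.trans ?_
      exact Real.exp_le_one_iff.mpr (by linarith)
    have hsq : Real.sqrt c ≤ 1 := by
      rw [Real.sqrt_le_left (by norm_num)]; simpa using hc1
    rw [min_eq_right hsq, hlogs, abs_of_nonpos (by linarith)]
    have : 1 - Real.log c / 2 ≤ 3 * -Real.log c := by linarith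
    calc _ ≤ c * (3 * -Real.log c) := by gcongr
      _ = _ := by ring
  · push Not at h
    have hlog : -1 - Real.sqrt 2 ≤ Real.log c := by
      rw [← Real.log_exp (-1 - Real.sqrt 2)]
      exact Real.log_le_log (Real.exp_pos _) h.le
    have h1 : 1 - Real.log (min 1 (Real.sqrt c)) ≤ 3 := by
      rcases min_cases 1 (Real.sqrt c) with h' | h' <;> rw [h'.1]
      · simp
      · rw [hlogs]; linarith
    have h2 : c ≤ Real.sqrt (c ^ 2 + 2 * (1 + Real.sqrt 2) * Real.exp (-1 - Real.sqrt 2) * c) := by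
      apply Real.le_sqrt_of_sq_le
      have : 0 ≤ 2 * (1 + Real.sqrt 2) * Real.exp (-1 - Real.sqrt 2) * c := by positivity
      linarith
    calc _ ≤ c * 3 := by gcongr
      _ ≤ _ := by linarith

lemma omegaMod_zero : omegaMod 0 = 0 := by
  unfold omegaMod
  rw [if_pos (Real.exp_pos _).le]; simp

lemma sq_integrable_of_IsP2 {d : ℕ} {μ : Measure (EuclideanSpace ℝ (Fin d))} (h : IsP2 d μ) :
    Integrable (fun x => ‖x‖ ^ 2) μ := by
  refine ⟨by fun_prop, ?_⟩
  rw [hasFiniteIntegral_iff_ofReal (Eventually.of_forall fun x => by positivity)]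
  refine lt_of_le_of_lt (le_of_eq ?_) h.2
  refine lintegral_congr fun x => ?_
  rw [ENNReal.ofReal_pow (norm_nonneg x), ofReal_norm]
  rfl

/-- The velocity field is square integrable. -/
lemma V_memLp (d : ℕ) {p q : ℝ} (hp1 : 2 - (d : ℝ) ≤ p) (hp2 : p < 0)
    (hq1 : 0 < q) (hq2 : q ≤ 2) {μ : Measure (EuclideanSpace ℝ (Fin d))} (hμ : IsP2 d μ)
    {M : ℝ} (hM : 0 ≤ M)
    (hG : ∀ x, ∫⁻ y, ENNReal.ofReal (Gr d 1 ‖x - y‖) ∂μ ≤ ENNReal.ofReal M) :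
    (∀ x, Integrable (fun y => gradK d p q (x - y)) μ) ∧
    MemLp (fun x => ∫ y, gradK d p q (x - y) ∂μ) 2 μ := by
  have hprob := hμ.1
  have hmG := Gr_measurable d 1
  have hmK := gradK_measurable d p q
  have hsq := sq_integrable_of_IsP2 hμ
  have hL2 : MemLp (fun x : EuclideanSpace ℝ (Fin d) => ‖x‖) 2 μ := by
    rw [memLp_two_iff_integrable_sq (by fun_prop)]
    exact hsq
  have hL1 : Integrable (fun x : EuclideanSpace ℝ (Fin d) => ‖x‖) μ :=
    hL2.integrable (by norm_num)
  have hGnn : ∀ a : EuclideanSpace ℝ (Fin d), 0 ≤ Gr d 1 ‖a‖ := fun a =>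
    zero_le_one.trans (Gr_ge_one d one_pos (norm_nonneg a))
  have hGi : ∀ x, Integrable (fun y => Gr d 1 ‖x - y‖) μ := fun x => by
    refine ⟨(hmG.comp (measurable_const.sub measurable_id).norm).aestronglyMeasurable, ?_⟩
    rw [hasFiniteIntegral_iff_ofReal (Eventually.of_forall fun y => hGnn _)]
    exact (hG x).trans_lt ENNReal.ofReal_lt_top
  have hGle : ∀ x, ∫ y, Gr d 1 ‖x - y‖ ∂μ ≤ M := fun x => by
    have := hG x
    rw [← ofReal_integral_eq_lintegral_ofReal (hGi x) (Eventually.of_forall fun y => hGnn _)] at this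
    exact (ENNReal.ofReal_le_ofReal_iff hM).mp this
  have hpt : ∀ x y : EuclideanSpace ℝ (Fin d),
      ‖gradK d p q (x - y)‖ ≤ 2 * (Gr d 1 ‖x - y‖ + (‖x‖ + ‖y‖)) := fun x y => by
    have h1 := gradK_bound d hp1 hp2 hq1 hq2 (x - y)
    have h2 := max_mul_Gr_le d (norm_nonneg (x - y))
    have h3 := norm_sub_le x y
    linarith
  have hdom : ∀ x, Integrable (fun y => 2 * (Gr d 1 ‖x - y‖ + (‖x‖ + ‖y‖))) μ := fun x =>
    ((hGi x).add ((integrable_const _).add hL1)).const_mul 2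
  refine ⟨fun x => (hdom x).mono'
    (hmK.comp (measurable_const.sub measurable_id)).aestronglyMeasurable (Eventually.of_forall (hpt x)), ?_⟩
  have hmeasV : AEStronglyMeasurable (fun x => ∫ y, gradK d p q (x - y) ∂μ) μ := by
    have : StronglyMeasurable (fun w : EuclideanSpace ℝ (Fin d) × EuclideanSpace ℝ (Fin d) =>
      gradK d p q (w.1 - w.2)) :=
      (hmK.comp (measurable_fst.sub measurable_snd)).stronglyMeasurable
    exact this.integral_prod_right'.aestronglyMeasurable
  set B : ℝ := ∫ y, ‖y‖ ∂μ with hB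
  have hc2 : MemLp (fun _ : EuclideanSpace ℝ (Fin d) => 2 * (M + B)) 2 μ := memLp_const _
  have hx2 : MemLp (fun x : EuclideanSpace ℝ (Fin d) => 2 * ‖x‖) 2 μ := hL2.const_mul 2
  have hdom2 : MemLp (fun x : EuclideanSpace ℝ (Fin d) => 2 * (M + B) + 2 * ‖x‖) 2 μ :=
    hc2.add hx2
  have hval : ∀ x, ∫ y, 2 * (Gr d 1 ‖x - y‖ + (‖x‖ + ‖y‖)) ∂μ =
      2 * ((∫ y, Gr d 1 ‖x - y‖ ∂μ) + (‖x‖ + B)) := fun x => by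
    have e1 : ∫ y, (‖x‖ + ‖y‖) ∂μ = ‖x‖ + B := by
      rw [integral_add (integrable_const _) hL1, integral_const, probReal_univ, one_smul]
    have e0 : Integrable (fun y => ‖x‖ + ‖y‖) μ := (integrable_const _).add hL1
    rw [integral_const_mul, integral_add (hGi x) e0, e1]
  have hbd : ∀ x, ‖∫ y, gradK d p q (x - y) ∂μ‖ ≤ 2 * (M + B) + 2 * ‖x‖ := fun x => by
    have e2 := norm_integral_le_of_norm_le (hdom x) (Eventually.of_forall (hpt x))
    rw [hval x] at e2
    have e3 := hGle x
    linarith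
  exact hdom2.mono' hmeasV (Eventually.of_forall hbd)

lemma cauchy_schwarz_L2 {Ω F : Type*} [MeasurableSpace Ω] [NormedAddCommGroup F]
    [InnerProductSpace ℝ F] {γ : Measure Ω} {f g : Ω → F} (hf : MemLp f 2 γ) (hg : MemLp g 2 γ) :
    |∫ z, inner ℝ (f z) (g z) ∂γ| ≤
      Real.sqrt (∫ z, ‖f z‖ ^ 2 ∂γ) * Real.sqrt (∫ z, ‖g z‖ ^ 2 ∂γ) := by
  have h := integral_mul_norm_le_Lp_mul_Lq (μ := γ) (f := f) (g := g)
    (p := 2) (q := 2) Real.HolderConjugate.two_two (by simpa using hf) (by simpa using hg)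
  have hi : Integrable (fun z => ‖f z‖ * ‖g z‖) γ := hf.norm.integrable_mul hg.norm
  refine le_trans ?_ (h.trans (le_of_eq ?_))
  · rw [← Real.norm_eq_abs]
    refine norm_integral_le_of_norm_le hi (Eventually.of_forall fun z => ?_)
    exact norm_inner_le_norm _ _
  · simp only [Real.sqrt_eq_rpow, Real.rpow_two]


section Core

variable (d : ℕ) {p q : ℝ}
   (γ : Measure (EuclideanSpace ℝ (Fin d) × EuclideanSpace ℝ (Fin d))) [IsProbabilityMeasure γ]

/-- The energy of a marginal, as an integral over the product of the coupling with itself. -/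
lemma energy_eq {μ : Measure (EuclideanSpace ℝ (Fin d))}
    {π : EuclideanSpace ℝ (Fin d) × EuclideanSpace ℝ (Fin d) → EuclideanSpace ℝ (Fin d)}
    (hπ : Measurable π) (hγ : γ.map π = μ)
    (hi : Integrable (fun w : (EuclideanSpace ℝ (Fin d) × EuclideanSpace ℝ (Fin d)) ×
      (EuclideanSpace ℝ (Fin d) × EuclideanSpace ℝ (Fin d)) => Kfun d p q (π w.1 - π w.2))
      (γ.prod γ)) :
    energyReal d p q μ = ∫ w, Kfun d p q (π w.1 - π w.2) ∂(γ.prod γ) := by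
  have hm := Kfun_measurable d p q
  rw [integral_prod _ hi]
  unfold energyReal
  subst hγ
  have h1 : ∀ x, ∫ y, Kfun d p q (x - y) ∂(γ.map π) = ∫ z, Kfun d p q (x - π z) ∂γ := fun x =>
    integral_map hπ.aemeasurable
      (hm.comp (measurable_const.sub measurable_id)).aestronglyMeasurable
  simp only [h1]
  refine integral_map hπ.aemeasurable ?_
  have : StronglyMeasurable (fun w : EuclideanSpace ℝ (Fin d) ×
      (EuclideanSpace ℝ (Fin d) × EuclideanSpace ℝ (Fin d)) => Kfun d p q (w.1 - π w.2)) :=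
    (hm.comp (measurable_fst.sub (hπ.comp measurable_snd))).stronglyMeasurable
  exact this.integral_prod_right'.aestronglyMeasurable


end Core

lemma hwi_core (d : ℕ) {p q : ℝ} (hp1 : 2 - (d : ℝ) ≤ p) (hp2 : p < 0)
    (hq1 : 0 < q) (hq2 : q ≤ 2) {A C0 : ℝ} (hA : 0 < A) (hC0 : 0 < C0)
    (hT : ∀ ε : ℝ, 0 < ε → ∀ a b : EuclideanSpace ℝ (Fin d),
      |Kfun d p q b - Kfun d p q a - inner ℝ (gradK d p q a) (b - a)| ≤
        C0 * ((‖b - a‖ ^ 2 + ε ^ 2) * (Gr d ε ‖a‖ + Gr d ε ‖b‖)))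
    {μ ν : Measure (EuclideanSpace ℝ (Fin d))} (hμ : IsP2 d μ) (hν : IsP2 d ν)
    (hμA : ∀ ε : ℝ, 0 < ε → ε ≤ 1 → ∀ x,
      ∫⁻ y, ENNReal.ofReal (Gr d ε ‖x - y‖) ∂μ ≤ ENNReal.ofReal (A * (1 - Real.log ε)))
    (hνA : ∀ ε : ℝ, 0 < ε → ε ≤ 1 → ∀ x,
      ∫⁻ y, ENNReal.ofReal (Gr d ε ‖x - y‖) ∂ν ≤ ENNReal.ofReal (A * (1 - Real.log ε)))
    (γ : Measure (EuclideanSpace ℝ (Fin d) × EuclideanSpace ℝ (Fin d))) [IsProbabilityMeasure γ]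
    (hγ1 : γ.map Prod.fst = μ) (hγ2 : γ.map Prod.snd = ν) :
    |energyReal d p q μ - energyReal d p q ν|
            ≤ 2 * Real.sqrt (∫ x, ‖∫ y, gradK d p q (x - y) ∂μ‖ ^ 2 ∂μ)
                * Real.sqrt (∫ z, ‖z.1 - z.2‖ ^ 2 ∂γ)
              + 36 * C0 * A * omegaMod (∫ z, ‖z.1 - z.2‖ ^ 2 ∂γ) := by
  have hmK := Kfun_measurable d p q
  have hmg := gradK_measurable d p q
  have hxi : Integrable (fun z : EuclideanSpace ℝ (Fin d) × EuclideanSpace ℝ (Fin d) =>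
      ‖z.1‖ ^ 2) γ := by
    have := sq_integrable_of_IsP2 hμ
    rw [← hγ1] at this
    exact this.comp_measurable measurable_fst
  have hyi : Integrable (fun z : EuclideanSpace ℝ (Fin d) × EuclideanSpace ℝ (Fin d) =>
      ‖z.2‖ ^ 2) γ := by
    have := sq_integrable_of_IsP2 hν
    rw [← hγ2] at this
    exact this.comp_measurable measurable_snd
  have hsqle : ∀ a b : EuclideanSpace ℝ (Fin d), ‖a - b‖ ^ 2 ≤ 2 * ‖a‖ ^ 2 + 2 * ‖b‖ ^ 2 :=
    fun a b => by
      have h1 := norm_sub_le a b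
      have h2 : ‖a - b‖ ^ 2 ≤ (‖a‖ + ‖b‖) ^ 2 := by gcongr
      nlinarith [sq_nonneg (‖a‖ - ‖b‖)]
  have hci : Integrable (fun z : EuclideanSpace ℝ (Fin d) × EuclideanSpace ℝ (Fin d) =>
      ‖z.1 - z.2‖ ^ 2) γ := by
    refine ((hxi.const_mul 2).add (hyi.const_mul 2)).mono' (by fun_prop)
      (Eventually.of_forall fun z => ?_)
    rw [Real.norm_of_nonneg (by positivity)]
    exact hsqle _ _
  set c := ∫ z, ‖z.1 - z.2‖ ^ 2 ∂γ with hc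
  have hc0 : 0 ≤ c := integral_nonneg fun z => by positivity
  rcases hc0.eq_or_lt with hcz | hcpos
  · -- degenerate case
    have h1 := (integral_eq_zero_iff_of_nonneg (fun z => by positivity) hci).mp hcz.symm
    have h2 : (Prod.fst : EuclideanSpace ℝ (Fin d) × EuclideanSpace ℝ (Fin d) → _) =ᵐ[γ]
        Prod.snd := by
      filter_upwards [h1] with z hz
      have hz : ‖z.1 - z.2‖ ^ 2 = 0 := hz
      exact sub_eq_zero.mp (norm_eq_zero.mp (pow_eq_zero_iff (by norm_num) |>.mp hz))
    have h3 : μ = ν := by rw [← hγ1, ← hγ2]; exact Measure.map_congr h2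
    rw [h3, ← hcz, omegaMod_zero]
    simp
  -- transfer of the `G` bounds to `γ`
  have hG1 : ∀ ε : ℝ, 0 < ε → ε ≤ 1 → ∀ x, ∫⁻ z, ENNReal.ofReal (Gr d ε ‖x - z.1‖) ∂γ ≤
      ENNReal.ofReal (A * (1 - Real.log ε)) := fun ε h0 h1 x => by
    have := hμA ε h0 h1 x
    have hm := Gr_measurable d ε
    rwa [← hγ1, lintegral_map (by fun_prop) measurable_fst] at this
  have hG2 : ∀ ε : ℝ, 0 < ε → ε ≤ 1 → ∀ x, ∫⁻ z, ENNReal.ofReal (Gr d ε ‖x - z.2‖) ∂γ ≤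
      ENNReal.ofReal (A * (1 - Real.log ε)) := fun ε h0 h1 x => by
    have := hνA ε h0 h1 x
    have hm := Gr_measurable d ε
    rwa [← hγ2, lintegral_map (by fun_prop) measurable_snd] at this
  have hdouble : ∀ ε : ℝ, 0 < ε → ε ≤ 1 → ∀ f : EuclideanSpace ℝ (Fin d) ×
      EuclideanSpace ℝ (Fin d) → ℝ, Measurable f → (∀ z, 0 ≤ f z) → Integrable f γ → _ :=
    fun ε h0 h1 f hf hf0 hfi =>
      double_real γ (G := fun a => Gr d ε ‖a‖) (M := A * (1 - Real.log ε))
        ((Gr_measurable d ε).comp measurable_norm)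
        (fun a => zero_le_one.trans (Gr_ge_one d h0 (norm_nonneg a)))
        (fun a => by simp only [norm_neg])
        (by have := Real.log_nonpos h0.le h1
            have : 0 ≤ 1 - Real.log ε := by linarith
            positivity)
        (hG1 ε h0 h1) (hG2 ε h0 h1) hf hf0 hfi
  -- the dominating function
  have hdom := (hdouble 1 one_pos le_rfl (fun z => 1 + ‖z.1‖ ^ 2 + ‖z.2‖ ^ 2) (by fun_prop)
    (fun z => by positivity) (((integrable_const 1).add hxi).add hyi)).1
  set Φ : (EuclideanSpace ℝ (Fin d) × EuclideanSpace ℝ (Fin d)) ×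
      (EuclideanSpace ℝ (Fin d) × EuclideanSpace ℝ (Fin d)) → ℝ := fun w =>
    ((1 + ‖w.1.1‖ ^ 2 + ‖w.1.2‖ ^ 2) + (1 + ‖w.2.1‖ ^ 2 + ‖w.2.2‖ ^ 2)) *
      (Gr d 1 ‖w.1.1 - w.2.1‖ + Gr d 1 ‖w.1.2 - w.2.2‖) with hΦ
  have hdom : Integrable Φ (γ.prod γ) := hdom
  have hGnn : ∀ a : EuclideanSpace ℝ (Fin d), 0 ≤ Gr d 1 ‖a‖ := fun a =>
    zero_le_one.trans (Gr_ge_one d one_pos (norm_nonneg a))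
  have hmax : ∀ a : EuclideanSpace ℝ (Fin d), max ‖a‖ 1 ^ 2 ≤ 1 + ‖a‖ ^ 2 := fun a => by
    rcases max_cases ‖a‖ 1 with h | h <;> rw [h.1] <;> nlinarith [sq_nonneg ‖a‖]
  have hCK : 0 < 1 / q + 1 / |p| := by
    have : 0 < |p| := abs_pos.mpr hp2.ne
    positivity
  have iK1 : Integrable (fun w : (EuclideanSpace ℝ (Fin d) × EuclideanSpace ℝ (Fin d)) ×
      (EuclideanSpace ℝ (Fin d) × EuclideanSpace ℝ (Fin d)) => Kfun d p q (w.1.1 - w.2.1))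
      (γ.prod γ) := by
    refine (hdom.const_mul ((1 / q + 1 / |p|) * 2)).mono'
      (hmK.comp (by fun_prop)).aestronglyMeasurable (Eventually.of_forall fun w => ?_)
    have h1 := Kfun_bound d hp1 hp2 hq1 hq2 (w.1.1 - w.2.1)
    have h2 := (hmax (w.1.1 - w.2.1)).trans (add_le_add le_rfl (hsqle w.1.1 w.2.1))
    rw [Real.norm_eq_abs, mul_assoc]
    refine h1.trans (mul_le_mul_of_nonneg_left ?_ hCK.le)
    rw [hΦ, ← mul_assoc]
    refine mul_le_mul ?_ ?_ (hGnn _) (by positivity)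
    · linarith [sq_nonneg ‖w.1.2‖, sq_nonneg ‖w.2.2‖]
    · linarith [hGnn (w.1.2 - w.2.2)]
  have iK2 : Integrable (fun w : (EuclideanSpace ℝ (Fin d) × EuclideanSpace ℝ (Fin d)) ×
      (EuclideanSpace ℝ (Fin d) × EuclideanSpace ℝ (Fin d)) => Kfun d p q (w.1.2 - w.2.2))
      (γ.prod γ) := by
    refine (hdom.const_mul ((1 / q + 1 / |p|) * 2)).mono'
      (hmK.comp (by fun_prop)).aestronglyMeasurable (Eventually.of_forall fun w => ?_)
    have h1 := Kfun_bound d hp1 hp2 hq1 hq2 (w.1.2 - w.2.2)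
    have h2 := (hmax (w.1.2 - w.2.2)).trans (add_le_add le_rfl (hsqle w.1.2 w.2.2))
    rw [Real.norm_eq_abs, mul_assoc]
    refine h1.trans (mul_le_mul_of_nonneg_left ?_ hCK.le)
    rw [hΦ, ← mul_assoc]
    refine mul_le_mul ?_ ?_ (hGnn _) (by positivity)
    · linarith [sq_nonneg ‖w.1.1‖, sq_nonneg ‖w.2.1‖]
    · linarith [hGnn (w.1.1 - w.2.1)]
  have iI1 : Integrable (fun w : (EuclideanSpace ℝ (Fin d) × EuclideanSpace ℝ (Fin d)) ×
      (EuclideanSpace ℝ (Fin d) × EuclideanSpace ℝ (Fin d)) =>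
      (inner ℝ (gradK d p q (w.1.1 - w.2.1)) (w.1.2 - w.1.1) : ℝ)) (γ.prod γ) := by
    refine (hdom.const_mul 4).mono' ?_ (Eventually.of_forall fun w => ?_)
    · refine Measurable.aestronglyMeasurable ?_
      exact (hmg.comp (by fun_prop)).inner (by fun_prop)
    have h1 := gradK_bound d hp1 hp2 hq1 hq2 (w.1.1 - w.2.1)
    have h2 := (hmax (w.1.1 - w.2.1)).trans (add_le_add le_rfl (hsqle w.1.1 w.2.1))
    have h3 := hsqle w.1.2 w.1.1
    have hm0 : 0 ≤ max ‖w.1.1 - w.2.1‖ 1 := le_max_of_le_right zero_le_one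
    have h4 : max ‖w.1.1 - w.2.1‖ 1 * ‖w.1.2 - w.1.1‖ ≤
        2 * ((1 + ‖w.1.1‖ ^ 2 + ‖w.1.2‖ ^ 2) + (1 + ‖w.2.1‖ ^ 2 + ‖w.2.2‖ ^ 2)) := by
      have := two_mul_le_add_sq (max ‖w.1.1 - w.2.1‖ 1) ‖w.1.2 - w.1.1‖
      linarith [sq_nonneg ‖w.1.1‖, sq_nonneg ‖w.1.2‖, sq_nonneg ‖w.2.1‖, sq_nonneg ‖w.2.2‖]
    calc _ ≤ ‖gradK d p q (w.1.1 - w.2.1)‖ * ‖w.1.2 - w.1.1‖ := norm_inner_le_norm _ _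
      _ ≤ (2 * (max ‖w.1.1 - w.2.1‖ 1 * Gr d 1 ‖w.1.1 - w.2.1‖)) * ‖w.1.2 - w.1.1‖ := by gcongr
      _ = 2 * ((max ‖w.1.1 - w.2.1‖ 1 * ‖w.1.2 - w.1.1‖) * Gr d 1 ‖w.1.1 - w.2.1‖) := by ring
      _ ≤ 2 * ((2 * ((1 + ‖w.1.1‖ ^ 2 + ‖w.1.2‖ ^ 2) + (1 + ‖w.2.1‖ ^ 2 + ‖w.2.2‖ ^ 2))) *
          (Gr d 1 ‖w.1.1 - w.2.1‖ + Gr d 1 ‖w.1.2 - w.2.2‖)) := by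
            refine mul_le_mul_of_nonneg_left ?_ (by norm_num)
            refine mul_le_mul h4 ?_ (hGnn _) (by positivity)
            linarith [hGnn (w.1.2 - w.2.2)]
      _ = 4 * Φ w := by rw [hΦ]; ring
  -- the swapped first order term
  have hswap : ∀ w : (EuclideanSpace ℝ (Fin d) × EuclideanSpace ℝ (Fin d)) ×
      (EuclideanSpace ℝ (Fin d) × EuclideanSpace ℝ (Fin d)),
      (inner ℝ (gradK d p q (w.1.1 - w.2.1)) (w.2.2 - w.2.1) : ℝ) =
      -(inner ℝ (gradK d p q (w.swap.1.1 - w.swap.2.1)) (w.swap.1.2 - w.swap.1.1) : ℝ) :=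
    fun w => by
      rw [← inner_neg_left, ← gradK_neg, neg_sub]; rfl
  have iI2 : Integrable (fun w : (EuclideanSpace ℝ (Fin d) × EuclideanSpace ℝ (Fin d)) ×
      (EuclideanSpace ℝ (Fin d) × EuclideanSpace ℝ (Fin d)) =>
      (inner ℝ (gradK d p q (w.1.1 - w.2.1)) (w.2.2 - w.2.1) : ℝ)) (γ.prod γ) := by
    simp only [hswap]
    exact iI1.swap.neg
  have eI2 : ∫ w, (inner ℝ (gradK d p q (w.1.1 - w.2.1)) (w.2.2 - w.2.1) : ℝ) ∂(γ.prod γ) =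
      -∫ w, (inner ℝ (gradK d p q (w.1.1 - w.2.1)) (w.1.2 - w.1.1) : ℝ) ∂(γ.prod γ) := by
    simp only [hswap]
    rw [integral_neg, integral_prod_swap
      (fun w : (EuclideanSpace ℝ (Fin d) × EuclideanSpace ℝ (Fin d)) ×
      (EuclideanSpace ℝ (Fin d) × EuclideanSpace ℝ (Fin d)) =>
        (inner ℝ (gradK d p q (w.1.1 - w.2.1)) (w.1.2 - w.1.1) : ℝ))]
  -- the first order term
  obtain ⟨hVi, hV2⟩ := V_memLp d hp1 hp2 hq1 hq2 hμ (M := A) hA.le (by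
    have := hμA 1 one_pos le_rfl
    simpa using this)
  have eI1 : ∫ w, (inner ℝ (gradK d p q (w.1.1 - w.2.1)) (w.1.2 - w.1.1) : ℝ) ∂(γ.prod γ) =
      ∫ z, (inner ℝ (∫ y, gradK d p q (z.1 - y) ∂μ) (z.2 - z.1) : ℝ) ∂γ := by
    rw [integral_prod _ iI1]
    refine integral_congr_ae (Eventually.of_forall fun z => ?_)
    have hz : Integrable (fun z' : EuclideanSpace ℝ (Fin d) × EuclideanSpace ℝ (Fin d) =>
        gradK d p q (z.1 - z'.1)) γ := by
      have := hVi z.1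
      rw [← hγ1] at this
      exact this.comp_measurable measurable_fst
    have e1 : ∫ y, gradK d p q (z.1 - y) ∂μ = ∫ z', gradK d p q (z.1 - z'.1) ∂γ := by
      rw [← hγ1]
      exact integral_map measurable_fst.aemeasurable
        (hmg.comp (measurable_const.sub measurable_id)).aestronglyMeasurable
    simp only
    rw [e1, real_inner_comm, ← integral_inner hz]
    exact integral_congr_ae (Eventually.of_forall fun z' => real_inner_comm _ _)
  have hCS : |∫ z, (inner ℝ (∫ y, gradK d p q (z.1 - y) ∂μ) (z.2 - z.1) : ℝ) ∂γ| ≤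
      Real.sqrt (∫ x, ‖∫ y, gradK d p q (x - y) ∂μ‖ ^ 2 ∂μ) * Real.sqrt c := by
    have hV2' : MemLp (fun z : EuclideanSpace ℝ (Fin d) × EuclideanSpace ℝ (Fin d) =>
        ∫ y, gradK d p q (z.1 - y) ∂μ) 2 γ := by
      refine MemLp.comp_of_map (f := Prod.fst)
        (g := fun x => ∫ y, gradK d p q (x - y) ∂μ) ?_ measurable_fst.aemeasurable
      rw [hγ1]; exact hV2
    have hD2 : MemLp (fun z : EuclideanSpace ℝ (Fin d) × EuclideanSpace ℝ (Fin d) =>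
        z.2 - z.1) 2 γ := by
      rw [← memLp_norm_iff (by fun_prop), memLp_two_iff_integrable_sq (by fun_prop)]
      simp only [norm_sub_rev] at hci ⊢
      exact hci
    have h := cauchy_schwarz_L2 hV2' hD2
    have e1 : ∫ z : EuclideanSpace ℝ (Fin d) × EuclideanSpace ℝ (Fin d),
        ‖∫ y, gradK d p q (z.1 - y) ∂μ‖ ^ 2 ∂γ = ∫ x, ‖∫ y, gradK d p q (x - y) ∂μ‖ ^ 2 ∂μ := by
      have hms : AEStronglyMeasurable (fun x => ‖∫ y, gradK d p q (x - y) ∂μ‖ ^ 2) (γ.map Prod.fst) := by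
        rw [hγ1]
        exact (hV2.1.norm).pow 2
      rw [← integral_map measurable_fst.aemeasurable hms, hγ1]
    have e2 : ∫ z : EuclideanSpace ℝ (Fin d) × EuclideanSpace ℝ (Fin d), ‖z.2 - z.1‖ ^ 2 ∂γ = c := by
      rw [hc]
      exact integral_congr_ae (Eventually.of_forall fun z => by
        simp only [norm_sub_rev z.2 z.1])
    rw [e1, e2] at h
    exact h
  -- the remainder
  set ε := min 1 (Real.sqrt c) with hε
  have hε0 : 0 < ε := lt_min one_pos (Real.sqrt_pos.mpr hcpos)
  have hε1 : ε ≤ 1 := min_le_left _ _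
  have hεc : ε ^ 2 ≤ c := by
    have h1 : ε ≤ Real.sqrt c := min_le_right _ _
    calc ε ^ 2 ≤ Real.sqrt c ^ 2 := by gcongr
      _ = c := Real.sq_sqrt hc0
  have hfi : Integrable (fun z : EuclideanSpace ℝ (Fin d) × EuclideanSpace ℝ (Fin d) =>
      2 * ‖z.1 - z.2‖ ^ 2 + ε ^ 2) γ := (hci.const_mul 2).add (integrable_const _)
  obtain ⟨hrem1, hrem2⟩ := hdouble ε hε0 hε1 (fun z => 2 * ‖z.1 - z.2‖ ^ 2 + ε ^ 2)
    (by fun_prop) (fun z => by positivity) hfi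
  have hfint : ∫ z, (2 * ‖z.1 - z.2‖ ^ 2 + ε ^ 2) ∂γ ≤ 3 * c := by
    rw [integral_add (hci.const_mul 2) (integrable_const _), integral_const_mul, integral_const,
      probReal_univ, one_smul, ← hc]
    linarith
  have hlog : 0 ≤ 1 - Real.log ε := by
    have := Real.log_nonpos hε0.le hε1
    linarith
  have hGε : ∀ a : EuclideanSpace ℝ (Fin d), 0 ≤ Gr d ε ‖a‖ := fun a =>
    zero_le_one.trans (Gr_ge_one d hε0 (norm_nonneg a))
  have hN : |∫ w, (Kfun d p q (w.1.2 - w.2.2) - Kfun d p q (w.1.1 - w.2.1) -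
      ((inner ℝ (gradK d p q (w.1.1 - w.2.1)) (w.1.2 - w.1.1) : ℝ) -
        (inner ℝ (gradK d p q (w.1.1 - w.2.1)) (w.2.2 - w.2.1) : ℝ))) ∂(γ.prod γ)| ≤
      C0 * (4 * ((3 * c) * (A * (1 - Real.log ε)))) := by
    rw [← Real.norm_eq_abs]
    refine (norm_integral_le_of_norm_le (hrem1.const_mul C0)
      (Eventually.of_forall fun w => ?_)).trans ?_
    · have h1 := hT ε hε0 (w.1.1 - w.2.1) (w.1.2 - w.2.2)
      have e1 : (w.1.2 - w.2.2) - (w.1.1 - w.2.1) = (w.1.2 - w.1.1) - (w.2.2 - w.2.1) := by abel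
      have h2 := hsqle (w.1.2 - w.1.1) (w.2.2 - w.2.1)
      rw [e1, inner_sub_right] at h1
      rw [Real.norm_eq_abs]
      refine h1.trans ?_
      refine mul_le_mul_of_nonneg_left ?_ hC0.le
      refine mul_le_mul_of_nonneg_right ?_ (add_nonneg (hGε _) (hGε _))
      beta_reduce
      rw [norm_sub_rev w.1.1 w.1.2, norm_sub_rev w.2.1 w.2.2]
      linarith [sq_nonneg ε]
    · rw [integral_const_mul]
      refine mul_le_mul_of_nonneg_left (hrem2.trans ?_) hC0.le
      gcongr
  have iK : Integrable (fun w : (EuclideanSpace ℝ (Fin d) × EuclideanSpace ℝ (Fin d)) ×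
      (EuclideanSpace ℝ (Fin d) × EuclideanSpace ℝ (Fin d)) =>
      Kfun d p q (w.1.2 - w.2.2) - Kfun d p q (w.1.1 - w.2.1)) (γ.prod γ) := iK2.sub iK1
  have iI : Integrable (fun w : (EuclideanSpace ℝ (Fin d) × EuclideanSpace ℝ (Fin d)) ×
      (EuclideanSpace ℝ (Fin d) × EuclideanSpace ℝ (Fin d)) =>
      (inner ℝ (gradK d p q (w.1.1 - w.2.1)) (w.1.2 - w.1.1) : ℝ) -
        (inner ℝ (gradK d p q (w.1.1 - w.2.1)) (w.2.2 - w.2.1) : ℝ)) (γ.prod γ) := iI1.sub iI2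
  rw [integral_sub iK iI, integral_sub iK2 iK1, integral_sub iI1 iI2, eI2,
    eI1, ← energy_eq d γ measurable_fst hγ1 iK1, ← energy_eq d γ measurable_snd hγ2 iK2] at hN
  have hω := omega_bound hcpos
  rw [← hε] at hω
  have hfin : C0 * (4 * ((3 * c) * (A * (1 - Real.log ε)))) ≤ 36 * C0 * A * omegaMod c := by
    calc _ = 12 * C0 * A * (c * (1 - Real.log ε)) := by ring
      _ ≤ 12 * C0 * A * (3 * omegaMod c) := by gcongr
      _ = _ := by ring
  have hN' := abs_le.mp hN
  have hCS' := abs_le.mp hCS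
  rw [mul_assoc 2 (Real.sqrt _) (Real.sqrt _), abs_le]
  constructor
  · linarith [hN'.2, hCS'.2]
  · linarith [hN'.1, hCS'.1]

/-- HWI-type inequality on measures with density bounded by `R`. -/
theorem hwi_type_inequality
    (d : ℕ) (hd : 3 ≤ d) (p q : ℝ) (hp1 : 2 - (d : ℝ) ≤ p) (hp2 : p < 0)
    (hq1 : 0 < q) (hq2 : q ≤ 2)
    (R : ℝ) (hR : 0 < R) :
    ∃ C : ℝ, 0 < C ∧
      ∀ μ ν : Measure (EuclideanSpace ℝ (Fin d)), IsP2 d μ → IsP2 d ν →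
        HasBddDensity d μ R → HasBddDensity d ν R →
        ∀ γ : Measure (EuclideanSpace ℝ (Fin d) × EuclideanSpace ℝ (Fin d)),
          IsProbabilityMeasure γ → γ.map Prod.fst = μ → γ.map Prod.snd = ν →
          |energyReal d p q μ - energyReal d p q ν|
            ≤ 2 * Real.sqrt (∫ x, ‖∫ y, gradK d p q (x - y) ∂μ‖ ^ 2 ∂μ)
                * Real.sqrt (∫ z, ‖z.1 - z.2‖ ^ 2 ∂γ)
              + C * omegaMod (∫ z, ‖z.1 - z.2‖ ^ 2 ∂γ) := by
  obtain ⟨A, hA, hAb⟩ := lintegral_Gr_le d hd hR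
  obtain ⟨C0, hC0, hT⟩ := taylor_K d hp1 hp2 hq1 hq2
  refine ⟨36 * C0 * A, by positivity, ?_⟩
  intro μ ν hμ hν hμR hνR γ hγ hγ1 hγ2
  have hμp := hμ.1
  have hνp := hν.1
  exact hwi_core d hp1 hp2 hq1 hq2 hA hC0 hT hμ hν (hAb μ hμp hμR) (hAb ν hνp hνR) γ hγ1 hγ2
end
end

section
/- Fix R > 0 and let φ be a mollifier satisfying (M1)–(M3). Let ε_k → 0, let μ_k be Borel probability measures on ℝ^d that are absolutely continuous with densities bounded by R and satisfy sup_k E_{ε_k}(μ_k) < ∞, and suppose μ_k → μ weakly-*, where μ is absolutely continuous with density bounded by R. Then for every f ∈ C_c^∞(ℝ^d), ∫_{ℝ^d} f(x) ((∇K_{ε_k})*μ_k)(x) dμ_k(x) → ∫_{ℝ^d} f(x) ((∇K)*μ)(x) dμ(x) as k → ∞. -/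
open MeasureTheory Filter
open scoped ENNReal Topology NNReal

noncomputable section

namespace NLT

lemma integrableOn_norm_rpow {d : ℕ} (hd : 1 ≤ d) {s : ℝ} (hs : -(d : ℝ) < s) (r : ℝ) :
    IntegrableOn (fun x : EuclideanSpace ℝ (Fin d) => ‖x‖ ^ s) (Metric.ball 0 r) volume := by
  refine integrableOn_ball_of_norm_le_rpow (C := 1) (α := -s) (by simpa using hd)
    (by simp; linarith) (Eventually.of_forall fun x => ?_) ?_
  · rw [neg_neg, one_mul, Real.norm_of_nonneg (by positivity)]
  · exact (measurable_norm.pow_const s).aestronglyMeasurable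

lemma norm_rpow_smul_self {d : ℕ} (s : ℝ) (v : EuclideanSpace ℝ (Fin d)) :
    ‖(‖v‖ ^ (s - 2)) • v‖ ≤ ‖v‖ ^ (s - 1) := by
  rw [norm_smul, Real.norm_of_nonneg (by positivity)]
  rcases eq_or_ne v 0 with rfl | hv
  · simp; positivity
  · have : 0 < ‖v‖ := norm_pos_iff.2 hv
    rw [show s - 1 = (s - 2) + 1 by ring, Real.rpow_add_one this.ne']

lemma norm_gradK_le {d : ℕ} (p q : ℝ) (v : EuclideanSpace ℝ (Fin d)) :
    ‖gradK d p q v‖ ≤ ‖v‖ ^ (q - 1) + ‖v‖ ^ (p - 1) := by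
  unfold gradK
  exact (norm_sub_le _ _).trans (add_le_add (norm_rpow_smul_self _ _) (norm_rpow_smul_self _ _))

lemma norm_gradK_le_near {d : ℕ} {p q : ℝ} (hpq : p ≤ q) {v : EuclideanSpace ℝ (Fin d)}
    (hv : ‖v‖ ≤ 1) : ‖gradK d p q v‖ ≤ 2 * ‖v‖ ^ (p - 1) := by
  rcases eq_or_ne v 0 with rfl | h0
  · simp [gradK]; positivity
  · have h := norm_gradK_le p q v
    have : ‖v‖ ^ (q - 1) ≤ ‖v‖ ^ (p - 1) :=
      Real.rpow_le_rpow_of_exponent_ge (norm_pos_iff.2 h0) hv (by linarith)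
    linarith

lemma norm_gradK_le_far {d : ℕ} {p q : ℝ} (hpq : p ≤ q) {n : ℝ} (hn : 1 ≤ n)
    {v : EuclideanSpace ℝ (Fin d)}
    (hv : n ≤ ‖v‖) : ‖gradK d p q v‖ ≤ 2 * ‖v‖ ^ q / n := by
  have h := norm_gradK_le p q v
  have h1 : 1 ≤ ‖v‖ := hn.trans hv
  have : ‖v‖ ^ (p - 1) ≤ ‖v‖ ^ (q - 1) :=
    Real.rpow_le_rpow_of_exponent_le h1 (by linarith)
  have h2 : ‖v‖ ^ q = ‖v‖ ^ (q - 1) * ‖v‖ := by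
    rw [← Real.rpow_add_one (by positivity)]; ring_nf
  have h3 : 0 ≤ ‖v‖ ^ (q - 1) := by positivity
  rw [le_div_iff₀ (by positivity), h2]
  have : ‖gradK d p q v‖ ≤ 2 * ‖v‖ ^ (q - 1) := by linarith
  calc _ ≤ (2 * ‖v‖ ^ (q - 1)) * ‖v‖ := by gcongr
    _ = _ := by ring

lemma measurable_gradK {d : ℕ} (p q : ℝ) : Measurable (gradK d p q) := by
  unfold gradK
  exact ((measurable_norm.pow_const _).smul measurable_id).sub
    ((measurable_norm.pow_const _).smul measurable_id)

/-- The cutoff. -/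
def cut (n : ℝ) (r : ℝ) : ℝ := max 0 (min 1 (n * r - 1)) * max 0 (min 1 (n + 1 - r))

lemma cut_nonneg (n r : ℝ) : 0 ≤ cut n r := by unfold cut; positivity

lemma cut_le_one (n r : ℝ) : cut n r ≤ 1 := by
  unfold cut
  exact mul_le_one₀ (by simp) (by positivity) (by simp)

lemma cut_eq_one {n r : ℝ} (hn : 0 < n) (h1 : 2 / n ≤ r) (h2 : r ≤ n) : cut n r = 1 := by
  unfold cut
  rw [div_le_iff₀ hn] at h1
  rw [min_eq_left (by linarith), min_eq_left (by linarith)]; simp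

lemma cut_eq_zero_near {n r : ℝ} (h1 : n * r ≤ 1) : cut n r = 0 := by
  unfold cut
  rw [max_eq_left (min_le_of_right_le (by linarith)), zero_mul]

lemma cut_eq_zero_far {n r : ℝ} (h1 : n + 1 ≤ r) : cut n r = 0 := by
  unfold cut
  rw [max_eq_left (a := 0) (b := min 1 (n + 1 - r)) (min_le_of_right_le (by linarith)), mul_zero]

lemma continuous_cut (n : ℝ) : Continuous (cut n) := by unfold cut; fun_prop

lemma continuous_cut_gradK {d : ℕ} (p q n : ℝ) (hn : 0 < n) :
    Continuous (fun v : EuclideanSpace ℝ (Fin d) => cut n ‖v‖ • gradK d p q v) := by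
  rw [continuous_iff_continuousAt]
  intro v
  rcases eq_or_ne v 0 with rfl | h0
  · refine ContinuousAt.congr (f := fun _ => (0 : EuclideanSpace ℝ (Fin d))) continuousAt_const ?_
    filter_upwards [Metric.ball_mem_nhds (0 : EuclideanSpace ℝ (Fin d)) (inv_pos.2 hn)] with v hv
    rw [cut_eq_zero_near, zero_smul]
    rw [mem_ball_zero_iff] at hv
    calc n * ‖v‖ ≤ n * n⁻¹ := by gcongr
      _ = 1 := mul_inv_cancel₀ hn.ne'
  · refine ((continuous_cut n).comp continuous_norm).continuousAt.smul ?_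
    unfold gradK
    have h : ‖v‖ ≠ 0 := norm_ne_zero_iff.2 h0
    exact ((continuous_norm.continuousAt.rpow_const (Or.inl h)).smul continuousAt_id).sub
      ((continuous_norm.continuousAt.rpow_const (Or.inl h)).smul continuousAt_id)

lemma bdd_cut_gradK {d : ℕ} (p q n : ℝ) (hn : 0 < n) :
    ∃ B, ∀ v : EuclideanSpace ℝ (Fin d), ‖cut n ‖v‖ • gradK d p q v‖ ≤ B := by
  refine (continuous_cut_gradK p q n hn).bounded_above_of_compact_support ?_
  refine HasCompactSupport.intro (isCompact_closedBall (0 : EuclideanSpace ℝ (Fin d)) (n + 1)) ?_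
  intro v hv
  rw [mem_closedBall_zero_iff, not_le] at hv
  rw [cut_eq_zero_far hv.le, zero_smul]

lemma cut_error {d : ℕ} {p q : ℝ} (hpq : p ≤ q) {n : ℝ} (hn : 2 ≤ n)
    (v : EuclideanSpace ℝ (Fin d)) :
    ‖gradK d p q v - cut n ‖v‖ • gradK d p q v‖ ≤
      (Metric.ball 0 (2 / n)).indicator (fun v => 2 * ‖v‖ ^ (p - 1)) v + 2 * ‖v‖ ^ q / n := by
  have e : gradK d p q v - cut n ‖v‖ • gradK d p q v = (1 - cut n ‖v‖) • gradK d p q v := by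
    rw [sub_smul, one_smul]
  have hc := cut_nonneg n ‖v‖
  have hc' := cut_le_one n ‖v‖
  have hle : ‖gradK d p q v - cut n ‖v‖ • gradK d p q v‖ ≤ ‖gradK d p q v‖ := by
    rw [e, norm_smul, Real.norm_of_nonneg (by linarith)]
    exact mul_le_of_le_one_left (norm_nonneg _) (by linarith)
  have hB : 0 ≤ 2 * ‖v‖ ^ q / n := by positivity
  have hn0 : 0 < n := by linarith
  by_cases h1 : v ∈ Metric.ball (0 : EuclideanSpace ℝ (Fin d)) (2 / n)
  · rw [Set.indicator_of_mem h1]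
    rw [mem_ball_zero_iff] at h1
    have : ‖v‖ ≤ 1 := h1.le.trans ((div_le_one hn0).2 hn)
    linarith [norm_gradK_le_near hpq this]
  · rw [Set.indicator_of_notMem h1, zero_add]
    rw [mem_ball_zero_iff, not_lt] at h1
    rcases le_total ‖v‖ n with h2 | h2
    · rw [cut_eq_one hn0 h1 h2, one_smul, sub_self, norm_zero]; exact hB
    · exact hle.trans (norm_gradK_le_far hpq (by linarith) h2)

lemma norm_gradK_le_all {d : ℕ} {p q : ℝ} (hpq : p ≤ q)
    (v : EuclideanSpace ℝ (Fin d)) :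
    ‖gradK d p q v‖ ≤
      (Metric.ball 0 1).indicator (fun v => 2 * ‖v‖ ^ (p - 1)) v + 2 * ‖v‖ ^ q := by
  by_cases h1 : v ∈ Metric.ball (0 : EuclideanSpace ℝ (Fin d)) 1
  · rw [Set.indicator_of_mem h1]
    rw [mem_ball_zero_iff] at h1
    have : 0 ≤ 2 * ‖v‖ ^ q := by positivity
    linarith [norm_gradK_le_near hpq h1.le]
  · rw [Set.indicator_of_notMem h1, zero_add]
    rw [mem_ball_zero_iff, not_lt] at h1
    simpa using norm_gradK_le_far hpq le_rfl h1

section pull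
variable {Ω : Type*} [MeasurableSpace Ω] {d : ℕ}

lemma integrable_comp_of_map_le {π : Measure Ω} {V : Ω → EuclideanSpace ℝ (Fin d)}
    (hV : Measurable V) {C : ℝ≥0∞} (hC : C ≠ ⊤) (h : π.map V ≤ C • volume)
    {g : EuclideanSpace ℝ (Fin d) → ℝ} (hg : Integrable g volume) :
    Integrable (fun ω => g (V ω)) π :=
  Integrable.comp_measurable ((hg.smul_measure hC).mono_measure h) hV

lemma integral_comp_le_of_map_le {π : Measure Ω} {V : Ω → EuclideanSpace ℝ (Fin d)}
    (hV : Measurable V) {C : ℝ≥0∞} (hC : C ≠ ⊤) (h : π.map V ≤ C • volume)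
    {g : EuclideanSpace ℝ (Fin d) → ℝ} (hg : Integrable g volume) (h0 : ∀ x, 0 ≤ g x) :
    ∫ ω, g (V ω) ∂π ≤ C.toReal * ∫ x, g x := by
  have h1 := (hg.smul_measure hC)
  rw [← integral_map hV.aemeasurable (h1.mono_measure h).aestronglyMeasurable]
  refine (integral_mono_measure h (Eventually.of_forall h0) h1).trans ?_
  rw [integral_smul_measure, smul_eq_mul]
end pull

section core
variable {Ω : Type*} [TopologicalSpace Ω] [MeasurableSpace Ω] [OpensMeasurableSpace Ω] {d : ℕ}

lemma moment_integrable {π : Measure Ω} {V : Ω → EuclideanSpace ℝ (Fin d)} (hV : Continuous V)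
    {q : ℝ} {D : ℝ≥0∞} (hD : D ≠ ⊤) (h : ∫⁻ ω, ENNReal.ofReal (‖V ω‖ ^ q) ∂π ≤ D) :
    Integrable (fun ω => ‖V ω‖ ^ q) π ∧ ∫ ω, ‖V ω‖ ^ q ∂π ≤ D.toReal := by
  have hm : AEStronglyMeasurable (fun ω => ‖V ω‖ ^ q) π :=
    (hV.measurable.norm.pow_const q).aestronglyMeasurable
  have h0 : 0 ≤ᵐ[π] (fun ω => ‖V ω‖ ^ q) := Eventually.of_forall fun ω => by positivity
  constructor
  · refine ⟨hm, ?_⟩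
    rw [hasFiniteIntegral_iff_ofReal h0]
    exact h.trans_lt hD.lt_top
  · rw [integral_eq_lintegral_of_nonneg_ae h0 hm]
    exact ENNReal.toReal_mono hD h

lemma integrable_fg (hd : 1 ≤ d) {p q : ℝ} (hp1 : 2 - (d : ℝ) ≤ p) (hpq : p ≤ q)
    {π : Measure Ω} {V : Ω → EuclideanSpace ℝ (Fin d)} (hV : Continuous V)
    {F : Ω → ℝ} (hF : Continuous F) {M : ℝ} (hM : ∀ ω, |F ω| ≤ M)
    {C : ℝ≥0∞} (hC : C ≠ ⊤) (h : π.map V ≤ C • volume)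
    {D : ℝ≥0∞} (hD : D ≠ ⊤) (hm : ∫⁻ ω, ENNReal.ofReal (‖V ω‖ ^ q) ∂π ≤ D) :
    Integrable (fun ω => F ω • gradK d p q (V ω)) π := by
  have hi := moment_integrable hV hD hm
  have h1 : Integrable ((Metric.ball (0 : EuclideanSpace ℝ (Fin d)) 1).indicator
      (fun v => 2 * ‖v‖ ^ (p - 1))) volume :=
    (integrable_indicator_iff Metric.isOpen_ball.measurableSet).2
      ((integrableOn_norm_rpow hd (by linarith) 1).const_mul 2)
  have h2 := ((integrable_comp_of_map_le hV.measurable hC h h1).add (hi.1.const_mul 2)).const_mul M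
  refine h2.mono' ?_ (Eventually.of_forall fun ω => ?_)
  · exact hF.measurable.aestronglyMeasurable.smul
      ((measurable_gradK p q).comp hV.measurable).aestronglyMeasurable
  · rw [norm_smul]
    have := norm_gradK_le_all hpq (V ω)
    exact mul_le_mul (hM ω) this (norm_nonneg _) ((abs_nonneg _).trans (hM ω))

lemma core_error (hd : 1 ≤ d) {p q : ℝ} (hp1 : 2 - (d : ℝ) ≤ p) (hpq : p ≤ q)
    {π : Measure Ω} [IsFiniteMeasure π] {V : Ω → EuclideanSpace ℝ (Fin d)} (hV : Continuous V)
    {F : Ω → ℝ} (hF : Continuous F) {M : ℝ} (hM : ∀ ω, |F ω| ≤ M) (hM0 : 0 ≤ M)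
    {C : ℝ≥0∞} (hC : C ≠ ⊤) (h : π.map V ≤ C • volume)
    {D : ℝ≥0∞} (hD : D ≠ ⊤) (hm : ∫⁻ ω, ENNReal.ofReal (‖V ω‖ ^ q) ∂π ≤ D)
    {n : ℝ} (hn : 2 ≤ n) :
    ‖∫ ω, F ω • gradK d p q (V ω) ∂π - ∫ ω, F ω • (cut n ‖V ω‖ • gradK d p q (V ω)) ∂π‖ ≤
      M * (C.toReal * (∫ v, (Metric.ball (0 : EuclideanSpace ℝ (Fin d)) (2 / n)).indicator
      (fun v => 2 * ‖v‖ ^ (p - 1)) v) + 2 / n * D.toReal) := by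
  have hi := moment_integrable hV hD hm
  have hn0 : 0 < n := by linarith
  have h1 : Integrable ((Metric.ball (0 : EuclideanSpace ℝ (Fin d)) (2 / n)).indicator
      (fun v => 2 * ‖v‖ ^ (p - 1))) volume :=
    (integrable_indicator_iff Metric.isOpen_ball.measurableSet).2
      ((integrableOn_norm_rpow hd (by linarith) _).const_mul 2)
  have hInt := integrable_fg hd hp1 hpq hV hF hM hC h hD hm
  obtain ⟨B, hB⟩ := bdd_cut_gradK (d := d) p q n hn0
  have hInt2 : Integrable (fun ω => F ω • (cut n ‖V ω‖ • gradK d p q (V ω))) π := by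
    refine Integrable.of_bound (C := M * B) ?_ (Eventually.of_forall fun ω => ?_)
    · exact (hF.smul ((continuous_cut_gradK p q n hn0).comp hV)).measurable.aestronglyMeasurable
    · rw [norm_smul]
      exact mul_le_mul (hM ω) (hB _) (norm_nonneg _) hM0
  rw [← integral_sub hInt hInt2]
  have hV1 := integrable_comp_of_map_le hV.measurable hC h h1
  have hV2 := hi.1.const_mul (2 / n)
  refine (norm_integral_le_of_norm_le ((hV1.add hV2).const_mul M)
    (Eventually.of_forall fun ω => ?_)).trans ?_
  · rw [← smul_sub, norm_smul]
    refine mul_le_mul (hM ω) ((cut_error hpq hn (V ω)).trans (le_of_eq ?_)) (norm_nonneg _) hM0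
    simp only [Pi.add_apply]
    ring
  · rw [integral_const_mul]
    refine mul_le_mul_of_nonneg_left ?_ hM0
    simp only [Pi.add_apply]
    rw [integral_add hV1 hV2, integral_const_mul]
    refine add_le_add (integral_comp_le_of_map_le hV.measurable hC h h1 fun x => ?_)
      (mul_le_mul_of_nonneg_left hi.2 (by positivity))
    exact Set.indicator_nonneg (fun _ _ => by positivity) _

lemma near_tendsto (hd : 1 ≤ d) {p : ℝ} (hp1 : 2 - (d : ℝ) ≤ p) :
    Tendsto (fun n : ℕ => ∫ v, (Metric.ball (0 : EuclideanSpace ℝ (Fin d)) (2 / (n : ℝ))).indicator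
      (fun v => 2 * ‖v‖ ^ (p - 1)) v) atTop (𝓝 0) := by
  have : Nonempty (Fin d) := ⟨⟨0, hd⟩⟩
  have h1 : Integrable ((Metric.ball (0 : EuclideanSpace ℝ (Fin d)) 2).indicator
      (fun v => 2 * ‖v‖ ^ (p - 1))) volume :=
    (integrable_indicator_iff Metric.isOpen_ball.measurableSet).2
      ((integrableOn_norm_rpow hd (by linarith) _).const_mul 2)
  have h2n : Tendsto (fun n : ℕ => 2 / (n : ℝ)) atTop (𝓝 0) :=
    tendsto_const_nhds.div_atTop tendsto_natCast_atTop_atTop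
  have := tendsto_integral_filter_of_dominated_convergence (l := atTop) (μ := volume)
    (F := fun (n : ℕ) v => (Metric.ball (0 : EuclideanSpace ℝ (Fin d)) (2 / (n : ℝ))).indicator
      (fun v => 2 * ‖v‖ ^ (p - 1)) v) (f := fun _ => (0 : ℝ)) _ ?_ ?_ h1 ?_
  · simpa using this
  · refine Eventually.of_forall fun n => ?_
    exact (((measurable_norm.pow_const _).const_mul 2).indicator
      Metric.isOpen_ball.measurableSet).aestronglyMeasurable
  · filter_upwards [eventually_ge_atTop 1] with n hn
    refine Eventually.of_forall fun v => ?_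
    rw [Real.norm_of_nonneg (Set.indicator_nonneg (fun _ _ => by positivity) _)]
    refine Set.indicator_le_indicator_of_subset (Metric.ball_subset_ball ?_)
      (fun _ => by positivity) v
    have : (1 : ℝ) ≤ n := by exact_mod_cast hn
    exact div_le_self (by norm_num) this
  · have h0 : ∀ᵐ v : EuclideanSpace ℝ (Fin d), v ≠ 0 := by
      exact Measure.ae_ne volume 0
    filter_upwards [h0] with v hv
    refine tendsto_const_nhds.congr' ?_
    filter_upwards [h2n.eventually (gt_mem_nhds (norm_pos_iff.2 hv))] with n hn
    rw [Set.indicator_of_notMem]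
    rw [mem_ball_zero_iff, not_lt]; exact hn.le

lemma tendsto_integral_vec {π : ℕ → ProbabilityMeasure Ω} {π' : ProbabilityMeasure Ω}
    (hπ : Tendsto π atTop (𝓝 π')) {h : Ω → EuclideanSpace ℝ (Fin d)} (hc : Continuous h)
    {B : ℝ} (hB : ∀ ω, ‖h ω‖ ≤ B) :
    Tendsto (fun k => ∫ ω, h ω ∂(π k : Measure Ω)) atTop (𝓝 (∫ ω, h ω ∂(π' : Measure Ω))) := by
  have hInt : ∀ ρ : ProbabilityMeasure Ω, Integrable h (ρ : Measure Ω) := fun ρ =>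
    Integrable.of_bound hc.measurable.aestronglyMeasurable (C := B) (Eventually.of_forall hB)
  have key : ∀ i, Tendsto (fun k => (∫ ω, h ω ∂(π k : Measure Ω)) i) atTop
      (𝓝 ((∫ ω, h ω ∂(π' : Measure Ω)) i)) := by
    intro i
    have e : ∀ ρ : ProbabilityMeasure Ω, (∫ ω, h ω ∂(ρ : Measure Ω)) i
        = ∫ ω, h ω i ∂(ρ : Measure Ω) := fun ρ =>
      ((EuclideanSpace.proj i : EuclideanSpace ℝ (Fin d) →L[ℝ] ℝ).integral_comp_comm (hInt ρ)).symm
    simp_rw [e]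
    have hci : Continuous fun ω => h ω i :=
      (EuclideanSpace.proj i : EuclideanSpace ℝ (Fin d) →L[ℝ] ℝ).continuous.comp hc
    exact (ProbabilityMeasure.tendsto_iff_forall_integral_tendsto.1 hπ)
      (BoundedContinuousFunction.ofNormedAddCommGroup (fun ω => h ω i) hci B
        fun ω => (PiLp.norm_apply_le (h ω) i).trans (hB ω))
  have := (PiLp.continuous_toLp 2 (fun _ : Fin d => ℝ)).continuousAt.tendsto.comp
    (tendsto_pi_nhds.2 key)
  exact this

lemma core_tendsto [HasOuterApproxClosed Ω] (hd : 1 ≤ d) {p q : ℝ} (hp1 : 2 - (d : ℝ) ≤ p)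
    (hpq : p ≤ q) (hq : 0 ≤ q)
    {π : ℕ → ProbabilityMeasure Ω} {π' : ProbabilityMeasure Ω} (hπ : Tendsto π atTop (𝓝 π'))
    {V : Ω → EuclideanSpace ℝ (Fin d)} (hV : Continuous V)
    {F : Ω → ℝ} (hF : Continuous F) {M : ℝ} (hM : ∀ ω, |F ω| ≤ M) (hM0 : 0 ≤ M)
    {C : ℝ≥0∞} (hC : C ≠ ⊤) (h : ∀ k, (π k : Measure Ω).map V ≤ C • volume)
    (h' : (π' : Measure Ω).map V ≤ C • volume)
    {D : ℝ≥0∞} (hD : D ≠ ⊤)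
    (hm : ∀ k, ∫⁻ ω, ENNReal.ofReal (‖V ω‖ ^ q) ∂(π k : Measure Ω) ≤ D) :
    Integrable (fun ω => F ω • gradK d p q (V ω)) (π' : Measure Ω) ∧
    Tendsto (fun k => ∫ ω, F ω • gradK d p q (V ω) ∂(π k : Measure Ω)) atTop
      (𝓝 (∫ ω, F ω • gradK d p q (V ω) ∂(π' : Measure Ω))) := by
  have hm' : ∫⁻ ω, ENNReal.ofReal (‖V ω‖ ^ q) ∂(π' : Measure Ω) ≤ D := by
    refine (lintegral_le_liminf_lintegral_of_forall_isOpen_measure_le_liminf_measure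
      (μs := fun k => (π k : Measure Ω)) (f := fun ω => ‖V ω‖ ^ q)
      (hV.norm.rpow_const fun _ => Or.inr hq) (fun ω => by simp only [Pi.zero_apply]; positivity)
      (fun G hG => ProbabilityMeasure.le_liminf_measure_open_of_tendsto hπ hG)).trans ?_
    refine liminf_le_of_le (by isBoundedDefault) fun b hb => ?_
    obtain ⟨k, hk⟩ := hb.exists
    exact hk.trans (hm k)
  refine ⟨integrable_fg hd hp1 hpq hV hF hM hC h' hD hm', ?_⟩
  set a : ℕ → ℝ := fun n => M * (C.toReal * (∫ v, (Metric.ball (0 : EuclideanSpace ℝ (Fin d))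
    (2 / (n : ℝ))).indicator (fun v => 2 * ‖v‖ ^ (p - 1)) v) + 2 / (n : ℝ) * D.toReal) with ha
  have h2n : Tendsto (fun n : ℕ => 2 / (n : ℝ)) atTop (𝓝 0) :=
    tendsto_const_nhds.div_atTop tendsto_natCast_atTop_atTop
  have ha0 : Tendsto a atTop (𝓝 0) := by
    have := (((near_tendsto hd hp1).const_mul C.toReal).add (h2n.mul_const D.toReal)).const_mul M
    simpa using this
  rw [Metric.tendsto_atTop]
  intro ε hε
  obtain ⟨n, hn, hn2⟩ := ((ha0.eventually (gt_mem_nhds (show (0 : ℝ) < ε / 3 by positivity))).and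
    (eventually_ge_atTop 2)).exists
  have hn2' : (2 : ℝ) ≤ n := by exact_mod_cast hn2
  obtain ⟨B, hB⟩ := bdd_cut_gradK (d := d) p q n (by linarith)
  have ht := tendsto_integral_vec hπ
    (hF.smul ((continuous_cut_gradK (d := d) p q n (by linarith)).comp hV))
    (B := M * B) (fun ω => by
      simp only [Pi.smul_apply', Function.comp]
      rw [norm_smul]; exact mul_le_mul (hM ω) (hB _) (norm_nonneg _) hM0)
  rw [Metric.tendsto_atTop] at ht
  obtain ⟨N, hN⟩ := ht (ε / 3) (by positivity)
  refine ⟨N, fun k hk => ?_⟩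
  have h1 := core_error hd hp1 hpq hV hF hM hM0 hC (h k) hD (hm k) hn2'
  have h2 := core_error hd hp1 hpq hV hF hM hM0 hC h' hD hm' hn2'
  have h3 := hN k hk
  rw [← dist_eq_norm] at h1 h2
  rw [dist_comm] at h2
  have h1' := h1.trans_lt hn
  have h2' := h2.trans_lt hn
  calc _ ≤ _ := dist_triangle4 _ _ _ _
    _ < ε / 3 + ε / 3 + ε / 3 := add_lt_add (add_lt_add h1' h3) h2'
    _ = ε := by ring
end core

section grad
variable {d : ℕ}

local notation "𝔼" => EuclideanSpace ℝ (Fin d)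

lemma map_sub_left_le {m : Measure 𝔼} {C : ℝ≥0∞} (h : m ≤ C • volume) (x : 𝔼) :
    m.map (fun w => x - w) ≤ C • volume := by
  have hm : Measurable (fun w : 𝔼 => x - w) := measurable_const.sub measurable_id
  refine (Measure.map_mono h hm).trans ?_
  rw [Measure.map_smul, (Measure.measurePreserving_sub_left volume x).map_eq]

lemma integrable_sq_shift {m : Measure 𝔼} [IsFiniteMeasure m]
    (h2 : Integrable (fun w => ‖w‖ ^ 2) m) (x : 𝔼) : Integrable (fun w => ‖x - w‖ ^ 2) m := by
  refine ((integrable_const (2 * ‖x‖ ^ 2)).add (h2.const_mul 2)).mono' (by fun_prop)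
    (Eventually.of_forall fun w => ?_)
  rw [Real.norm_of_nonneg (by positivity)]
  have := norm_sub_le x w
  have h0 := norm_nonneg (x - w)
  simp only [Pi.add_apply]
  nlinarith [sq_nonneg (‖x‖ - ‖w‖)]

lemma integrable_norm_of_sq {m : Measure 𝔼} [IsFiniteMeasure m]
    (h2 : Integrable (fun w => ‖w‖ ^ 2) m) : Integrable (fun w => ‖w‖) m := by
  refine ((integrable_const (1 : ℝ)).add h2).mono' (by fun_prop)
    (Eventually.of_forall fun w => ?_)
  rw [norm_norm]
  simp only [Pi.add_apply]
  nlinarith [sq_nonneg (‖w‖ - 1)]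

lemma integrable_rpow_shift (hd : 1 ≤ d) {m : Measure 𝔼} [IsFiniteMeasure m] {C : ℝ≥0∞}
    (hC : C ≠ ⊤) (h : m ≤ C • volume) (h2 : Integrable (fun w => ‖w‖ ^ 2) m) {t : ℝ}
    (ht : -(d : ℝ) < t) (ht2 : t ≤ 2) (x : 𝔼) : Integrable (fun w => ‖x - w‖ ^ t) m := by
  have h1 : Integrable ((Metric.ball (0 : 𝔼) 1).indicator (fun v => ‖v‖ ^ t)) volume :=
    (integrable_indicator_iff Metric.isOpen_ball.measurableSet).2
      (integrableOn_norm_rpow hd ht 1)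
  have hm : Measurable (fun w : 𝔼 => x - w) := measurable_const.sub measurable_id
  refine ((integrable_comp_of_map_le hm hC (map_sub_left_le h x) h1).add
    (integrable_sq_shift h2 x)).mono' (hm.norm.pow_const t).aestronglyMeasurable
    (Eventually.of_forall fun w => ?_)
  rw [Real.norm_of_nonneg (by positivity)]
  simp only [Pi.add_apply]
  by_cases hv : x - w ∈ Metric.ball (0 : 𝔼) 1
  · rw [Set.indicator_of_mem hv]
    linarith [sq_nonneg ‖x - w‖]
  · rw [Set.indicator_of_notMem hv, zero_add]
    rw [mem_ball_zero_iff, not_lt] at hv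
    rw [← Real.rpow_two]
    exact Real.rpow_le_rpow_of_exponent_le hv ht2

lemma integrable_rpow_smul_shift (hd : 1 ≤ d) {m : Measure 𝔼} [IsFiniteMeasure m] {C : ℝ≥0∞}
    (hC : C ≠ ⊤) (h : m ≤ C • volume) (h2 : Integrable (fun w => ‖w‖ ^ 2) m) {s : ℝ}
    (hs : 2 - (d : ℝ) ≤ s) (hs2 : s ≤ 2) (x : 𝔼) :
    Integrable (fun w => (‖x - w‖ ^ (s - 2)) • (x - w)) m := by
  have hm : Measurable (fun w : 𝔼 => x - w) := measurable_const.sub measurable_id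
  exact (integrable_rpow_shift hd hC h h2 (t := s - 1) (by linarith) (by linarith) x).mono'
    ((hm.norm.pow_const _).smul hm).aestronglyMeasurable
    (Eventually.of_forall fun w => norm_rpow_smul_self s (x - w))

lemma rpow_diff_bound {t δ a : ℝ} (ht : 0 < t) (hδ : 0 ≤ δ) (ha : a ≤ 0) :
    t ^ a - (t + δ) ^ a ≤ -a * δ * t ^ (a - 1) := by
  have e : t + δ = t * (1 + δ / t) := by field_simp
  have hx : 0 ≤ δ / t := by positivity
  have hpos : 0 < 1 + δ / t := by positivity
  rw [e, Real.mul_rpow ht.le hpos.le]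
  have h1 : 1 + a * (δ / t) ≤ (1 + δ / t) ^ a := by
    rw [Real.rpow_def_of_pos hpos]
    have l1 := Real.add_one_le_exp (Real.log (1 + δ / t) * a)
    have l2 := Real.log_le_sub_one_of_pos hpos
    nlinarith
  rw [Real.rpow_sub_one ht.ne']
  have h3 : 0 < t ^ a := by positivity
  have := mul_le_mul_of_nonneg_left h1 h3.le
  have e2 : -a * δ * (t ^ a / t) = - (t ^ a * (a * (δ / t))) := by ring
  rw [e2]
  nlinarith

/-- regularised gradient -/
def gr (s δ : ℝ) (v : 𝔼) : 𝔼 := ((‖v‖ ^ 2 + δ) ^ (s / 2 - 1)) • v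

/-- the inner product as a bilinear map -/
def LL : 𝔼 →L[ℝ] 𝔼 →L[ℝ] ℝ :=
  (isBoundedBilinearMap_inner (𝕜 := ℝ) (E := 𝔼)).toContinuousLinearMap

lemma LL_apply (v u : 𝔼) : LL v u = inner ℝ v u := rfl

lemma norm_LL_le (v : 𝔼) : ‖LL v‖ ≤ ‖v‖ :=
  ContinuousLinearMap.opNorm_le_bound _ (norm_nonneg _) fun u => by
    rw [LL_apply]; exact norm_inner_le_norm v u

lemma hasFDerivAt_reg {s δ : ℝ} (hs : s ≠ 0) (hδ : 0 < δ) (v : 𝔼) :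
    HasFDerivAt (fun v : 𝔼 => (‖v‖ ^ 2 + δ) ^ (s / 2) / s) (LL (gr s δ v)) v := by
  have h1 : HasFDerivAt (fun v : 𝔼 => ‖v‖ ^ 2 + δ) (2 • (innerSL ℝ v)) v :=
    (hasStrictFDerivAt_norm_sq v).hasFDerivAt.add_const δ
  have h2 := (h1.rpow_const (p := s / 2) (Or.inl (by positivity))).mul_const (s⁻¹)
  simp only [← div_eq_mul_inv] at h2
  refine h2.congr_fderiv ?_
  ext u
  simp only [gr, LL_apply, inner_smul_left, _root_.smul_apply, innerSL_apply_apply]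
  simp
  field_simp

lemma norm_gr_le {s δ : ℝ} (hs : s ≤ 2) (hδ : 0 < δ) (v : 𝔼) :
    ‖gr s δ v‖ ≤ δ ^ (s / 2 - 1) * ‖v‖ := by
  unfold gr
  rw [norm_smul, Real.norm_of_nonneg (by positivity)]
  exact mul_le_mul_of_nonneg_right
    (Real.rpow_le_rpow_of_nonpos hδ (by linarith [sq_nonneg ‖v‖]) (by linarith)) (norm_nonneg _)

lemma continuous_gr {s δ : ℝ} (hδ : 0 < δ) : Continuous (gr (d := d) s δ) := by
  unfold gr
  refine Continuous.smul (Continuous.rpow_const (by fun_prop) fun v => Or.inl ?_) continuous_id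
  positivity

lemma hasFDerivAt_reg_int {m : Measure 𝔼} [IsFiniteMeasure m]
    (h2 : Integrable (fun w => ‖w‖ ^ 2) m) {s δ : ℝ} (hs0 : s ≠ 0) (hs2 : s ≤ 2) (hδ : 0 < δ)
    (x : 𝔼) :
    HasFDerivAt (fun x : 𝔼 => ∫ w, (‖x - w‖ ^ 2 + δ) ^ (s / 2) / s ∂m)
      (∫ w, LL (gr s δ (x - w)) ∂m) x := by
  have hcont : ∀ x : 𝔼, Continuous fun w : 𝔼 => (‖x - w‖ ^ 2 + δ) ^ (s / 2) / s := fun x => by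
    refine Continuous.div_const (Continuous.rpow_const (by fun_prop) fun v => Or.inl ?_) _
    positivity
  refine hasFDerivAt_integral_of_dominated_of_fderiv_le (s := Metric.ball x 1)
    (F := fun (x : 𝔼) w => (‖x - w‖ ^ 2 + δ) ^ (s / 2) / s)
    (F' := fun x w => LL (gr s δ (x - w)))
    (bound := fun w => δ ^ (s / 2 - 1) * (‖x‖ + 1 + ‖w‖))
    (Metric.ball_mem_nhds x one_pos)
    (Eventually.of_forall fun x => (hcont x).aestronglyMeasurable) ?_ ?_ ?_ ?_ ?_
  · refine ((((integrable_sq_shift h2 x).add (integrable_const δ)).const_mul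
      (δ ^ (s / 2 - 1))).div_const |s|).mono' (hcont x).aestronglyMeasurable
      (Eventually.of_forall fun w => ?_)
    rw [norm_div, Real.norm_eq_abs s, Real.norm_of_nonneg (by positivity)]
    simp only [Pi.add_apply]
    have hu : 0 < ‖x - w‖ ^ 2 + δ := by positivity
    have e : (‖x - w‖ ^ 2 + δ) ^ (s / 2)
        = (‖x - w‖ ^ 2 + δ) ^ (s / 2 - 1) * (‖x - w‖ ^ 2 + δ) := by
      rw [← Real.rpow_add_one hu.ne']; ring_nf
    rw [e]
    exact div_le_div_of_nonneg_right (mul_le_mul_of_nonneg_right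
      (Real.rpow_le_rpow_of_nonpos hδ (by linarith [sq_nonneg ‖x - w‖]) (by linarith)) hu.le)
      (abs_nonneg s)
  · exact ((LL (d := d)).continuous.comp
      ((continuous_gr hδ).comp (continuous_const.sub continuous_id))).aestronglyMeasurable
  · refine Eventually.of_forall fun w y hy => (norm_LL_le _).trans ((norm_gr_le hs2 hδ _).trans ?_)
    gcongr
    have h1 : ‖y - x‖ < 1 := by rwa [← dist_eq_norm]
    calc ‖y - w‖ = ‖(y - x) + x - w‖ := by congr 1; abel
      _ ≤ ‖y - x‖ + ‖x‖ + ‖w‖ := (norm_sub_le _ _).trans (by gcongr; exact norm_add_le _ _)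
      _ ≤ _ := by linarith
  · exact ((integrable_const _).add (integrable_norm_of_sq h2)).const_mul _
  · refine Eventually.of_forall fun w y _ => ?_
    have := (hasFDerivAt_reg (d := d) hs0 hδ (y - w)).comp y ((hasFDerivAt_id y).sub_const w)
    simpa [Function.comp_def] using this

lemma sq_rpow_half {r : ℝ} (hr : 0 ≤ r) (s : ℝ) : (r ^ 2) ^ (s / 2 - 1) = r ^ (s - 2) := by
  rw [← Real.rpow_two, ← Real.rpow_mul hr]; ring_nf

lemma sq_rpow_half' {r : ℝ} (hr : 0 ≤ r) (s : ℝ) : (r ^ 2) ^ (s / 2) = r ^ s := by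
  rw [← Real.rpow_two, ← Real.rpow_mul hr]; ring_nf

lemma gr_diff_norm {s δ : ℝ} (hs : s ≤ 2) (hδ : 0 < δ) (v : 𝔼) :
    ‖gr s δ v - (‖v‖ ^ (s - 2)) • v‖
      = ((‖v‖ ^ 2) ^ (s / 2 - 1) - (‖v‖ ^ 2 + δ) ^ (s / 2 - 1)) * ‖v‖ := by
  rcases eq_or_ne v 0 with rfl | hv
  · simp [gr]
  have hv' : 0 < ‖v‖ := norm_pos_iff.2 hv
  have h1 : (‖v‖ ^ 2 + δ) ^ (s / 2 - 1) ≤ (‖v‖ ^ 2) ^ (s / 2 - 1) :=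
    Real.rpow_le_rpow_of_nonpos (by positivity) (by linarith) (by linarith)
  rw [gr, ← sq_rpow_half hv'.le, ← sub_smul, norm_smul, ← norm_neg, neg_sub,
    Real.norm_of_nonneg (by linarith)]

lemma gr_diff_near {s δ : ℝ} (hs : s ≤ 2) (hδ : 0 < δ) (v : 𝔼) :
    ‖gr s δ v - (‖v‖ ^ (s - 2)) • v‖ ≤ ‖v‖ ^ (s - 1) := by
  rw [gr_diff_norm hs hδ]
  refine le_trans ?_ (norm_rpow_smul_self s v)
  rw [norm_smul, Real.norm_of_nonneg (by positivity), sq_rpow_half (norm_nonneg _)]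
  gcongr
  have : 0 ≤ (‖v‖ ^ 2 + δ) ^ (s / 2 - 1) := by positivity
  linarith

lemma gr_diff_far {s δ : ℝ} (hs : s ≤ 2) (hδ : 0 < δ) {v : 𝔼} (hv : 1 ≤ ‖v‖) :
    ‖gr s δ v - (‖v‖ ^ (s - 2)) • v‖ ≤ (1 - s / 2) * δ := by
  rw [gr_diff_norm hs hδ]
  have h1 : (1 : ℝ) ≤ ‖v‖ ^ 2 := one_le_pow₀ hv
  have h := rpow_diff_bound (t := ‖v‖ ^ 2) (a := s / 2 - 1) (by linarith) hδ.le (by linarith)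
  have h3 : (‖v‖ ^ 2) ^ (s / 2 - 1 - 1) ≤ (‖v‖ ^ 2) ^ (-1 : ℝ) :=
    Real.rpow_le_rpow_of_exponent_le h1 (by linarith)
  have h4 : (‖v‖ ^ 2) ^ (-1 : ℝ) * ‖v‖ ≤ 1 := by
    rw [Real.rpow_neg_one, inv_mul_le_iff₀ (by linarith)]
    nlinarith
  have h5 : 0 ≤ (1 - s / 2) * δ := mul_nonneg (by linarith) hδ.le
  calc _ ≤ (-(s / 2 - 1) * δ * (‖v‖ ^ 2) ^ (s / 2 - 1 - 1)) * ‖v‖ := by gcongr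
    _ ≤ ((1 - s / 2) * δ * (‖v‖ ^ 2) ^ (-1 : ℝ)) * ‖v‖ := by
        rw [neg_sub]
        gcongr
    _ = ((1 - s / 2) * δ) * ((‖v‖ ^ 2) ^ (-1 : ℝ) * ‖v‖) := by ring
    _ ≤ ((1 - s / 2) * δ) * 1 := by gcongr
    _ = _ := mul_one _

lemma near_reg_tendsto (hd : 1 ≤ d) {s : ℝ} (hs : 2 - (d : ℝ) ≤ s) (hs2 : s ≤ 2)
    {δ : ℕ → ℝ} (hδ : ∀ n, 0 < δ n) (hδ0 : Tendsto δ atTop (𝓝 0)) :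
    Tendsto (fun n : ℕ => ∫ v, (Metric.ball (0 : 𝔼) 1).indicator
      (fun v => ‖gr s (δ n) v - (‖v‖ ^ (s - 2)) • v‖) v) atTop (𝓝 0) := by
  have : Nonempty (Fin d) := ⟨⟨0, hd⟩⟩
  have h1 : Integrable ((Metric.ball (0 : 𝔼) 1).indicator
      (fun v => ‖v‖ ^ (s - 1))) volume :=
    (integrable_indicator_iff Metric.isOpen_ball.measurableSet).2
      (integrableOn_norm_rpow hd (by linarith) _)
  have := tendsto_integral_filter_of_dominated_convergence (l := atTop) (μ := volume)
    (F := fun (n : ℕ) v => (Metric.ball (0 : 𝔼) 1).indicator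
      (fun v => ‖gr s (δ n) v - (‖v‖ ^ (s - 2)) • v‖) v) (f := fun _ => (0 : ℝ)) _ ?_ ?_ h1 ?_
  · simpa using this
  · refine Eventually.of_forall fun n => ?_
    exact ((((continuous_gr (hδ n)).measurable.sub
      ((measurable_norm.pow_const _).smul measurable_id)).norm).indicator
      Metric.isOpen_ball.measurableSet).aestronglyMeasurable
  · refine Eventually.of_forall fun n => Eventually.of_forall fun v => ?_
    rw [Real.norm_of_nonneg (Set.indicator_nonneg (fun _ _ => norm_nonneg _) _)]
    exact Set.indicator_le_indicator (gr_diff_near hs2 (hδ n) v)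
  · have h0 : ∀ᵐ v : 𝔼, v ≠ 0 := Measure.ae_ne volume 0
    filter_upwards [h0] with v hv
    by_cases hb : v ∈ Metric.ball (0 : 𝔼) 1
    · simp only [Set.indicator_of_mem hb]
      have hv' : 0 < ‖v‖ := norm_pos_iff.2 hv
      have ht : Tendsto (fun n => ‖v‖ ^ 2 + δ n) atTop (𝓝 (‖v‖ ^ 2)) := by
        simpa using hδ0.const_add (‖v‖ ^ 2)
      have h3 := (ht.rpow_const (p := s / 2 - 1) (Or.inl (by positivity))).smul_const v
      rw [sq_rpow_half hv'.le] at h3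
      have := (h3.sub_const ((‖v‖ ^ (s - 2)) • v)).norm
      simpa [gr] using this
    · simp only [Set.indicator_of_notMem hb]
      exact tendsto_const_nhds

lemma integrable_gr_shift {m : Measure 𝔼} [IsFiniteMeasure m]
    (h2 : Integrable (fun w => ‖w‖ ^ 2) m) {s δ : ℝ} (hs2 : s ≤ 2) (hδ : 0 < δ) (x : 𝔼) :
    Integrable (fun w => gr s δ (x - w)) m := by
  refine (((integrable_const ‖x‖).add (integrable_norm_of_sq h2)).const_mul
    (δ ^ (s / 2 - 1))).mono'
    ((continuous_gr hδ).comp (continuous_const.sub continuous_id)).aestronglyMeasurable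
    (Eventually.of_forall fun w => (norm_gr_le hs2 hδ _).trans ?_)
  exact mul_le_mul_of_nonneg_left (norm_sub_le _ _) (by positivity)

lemma ae_sub_ne (hd : 1 ≤ d) {m : Measure 𝔼} {C : ℝ≥0∞} (h : m ≤ C • volume) (x : 𝔼) :
    ∀ᵐ w ∂m, x - w ≠ 0 := by
  have : Nonempty (Fin d) := ⟨⟨0, hd⟩⟩
  have hac : m ≪ volume := (Measure.absolutelyContinuous_of_le h).trans
    Measure.smul_absolutelyContinuous
  filter_upwards [hac.ae_le (Measure.ae_ne volume x)] with w hw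
  exact sub_ne_zero.2 (Ne.symm hw)

lemma tendsto_reg_int (hd : 1 ≤ d) {m : Measure 𝔼} [IsFiniteMeasure m] {C : ℝ≥0∞}
    (hC : C ≠ ⊤) (h : m ≤ C • volume) (h2 : Integrable (fun w => ‖w‖ ^ 2) m) {s : ℝ}
    (hs : 2 - (d : ℝ) ≤ s) (hs2 : s ≤ 2)
    {δ : ℕ → ℝ} (hδ : ∀ n, 0 < δ n) (hδ1 : ∀ n, δ n ≤ 1) (hδ0 : Tendsto δ atTop (𝓝 0)) (x : 𝔼) :
    Tendsto (fun n => ∫ w, (‖x - w‖ ^ 2 + δ n) ^ (s / 2) / s ∂m) atTop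
      (𝓝 (∫ w, ‖x - w‖ ^ s / s ∂m)) := by
  have hb := ((((integrable_sq_shift h2 x).add (integrable_const (1 : ℝ))).add
    (integrable_rpow_shift hd hC h h2 (t := s) (by linarith) hs2 x)).div_const |s|)
  refine tendsto_integral_filter_of_dominated_convergence _ ?_ ?_ hb ?_
  · refine Eventually.of_forall fun n => Continuous.aestronglyMeasurable ?_
    refine Continuous.div_const (Continuous.rpow_const (by fun_prop) fun v => Or.inl ?_) _
    have := hδ n
    positivity
  · refine Eventually.of_forall fun n => ?_
    filter_upwards [ae_sub_ne hd h x] with w hw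
    have hδn := hδ n
    have hv' : 0 < ‖x - w‖ := norm_pos_iff.2 hw
    rw [norm_div, Real.norm_eq_abs s, Real.norm_of_nonneg (by positivity)]
    refine div_le_div_of_nonneg_right ?_ (abs_nonneg s)
    simp only [Pi.add_apply]
    have hr : 0 < ‖x - w‖ ^ s := by positivity
    rcases le_total 0 s with hs0 | hs0
    · have h1 : (‖x - w‖ ^ 2 + δ n) ^ (s / 2) ≤ (‖x - w‖ ^ 2 + 1) ^ (s / 2) :=
        Real.rpow_le_rpow (by positivity) (by linarith [hδ1 n]) (by linarith)
      have h3 : (‖x - w‖ ^ 2 + 1) ^ (s / 2) ≤ (‖x - w‖ ^ 2 + 1) ^ (1 : ℝ) :=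
        Real.rpow_le_rpow_of_exponent_le (by linarith [sq_nonneg ‖x - w‖]) (by linarith)
      rw [Real.rpow_one] at h3
      linarith
    · have h1 : (‖x - w‖ ^ 2 + δ n) ^ (s / 2) ≤ (‖x - w‖ ^ 2) ^ (s / 2) :=
        Real.rpow_le_rpow_of_nonpos (by positivity) (by linarith) (by linarith)
      rw [sq_rpow_half' hv'.le] at h1
      linarith [sq_nonneg ‖x - w‖]
  · filter_upwards [ae_sub_ne hd h x] with w hw
    have hv' : 0 < ‖x - w‖ := norm_pos_iff.2 hw
    have ht : Tendsto (fun n => ‖x - w‖ ^ 2 + δ n) atTop (𝓝 (‖x - w‖ ^ 2)) := by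
      simpa using hδ0.const_add (‖x - w‖ ^ 2)
    have h3 := (ht.rpow_const (p := s / 2) (Or.inl (by positivity))).div_const s
    rwa [sq_rpow_half' hv'.le] at h3

lemma hasFDerivAt_power (hd : 1 ≤ d) {m : Measure 𝔼} [IsFiniteMeasure m] {C : ℝ≥0∞}
    (hC : C ≠ ⊤) (h : m ≤ C • volume) (h2 : Integrable (fun w => ‖w‖ ^ 2) m) {s : ℝ}
    (hs : 2 - (d : ℝ) ≤ s) (hs2 : s ≤ 2) (hs0 : s ≠ 0) (x : 𝔼) :
    HasFDerivAt (fun x : 𝔼 => ∫ w, ‖x - w‖ ^ s / s ∂m)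
      (LL (∫ w, (‖x - w‖ ^ (s - 2)) • (x - w) ∂m)) x := by
  set δ : ℕ → ℝ := fun n => 1 / ((n : ℝ) + 1) with hδdef
  have hδ : ∀ n, 0 < δ n := fun n => Nat.one_div_pos_of_nat
  have hδ1 : ∀ n, δ n ≤ 1 := fun n => by
    rw [hδdef]; simp only
    rw [div_le_one (by positivity)]; linarith [Nat.cast_nonneg (α := ℝ) n]
  have hδ0 : Tendsto δ atTop (𝓝 0) := tendsto_one_div_add_atTop_nhds_zero_nat
  refine hasFDerivAt_of_tendstoUniformly (l := atTop)
    (f := fun (n : ℕ) (x : 𝔼) => ∫ w, (‖x - w‖ ^ 2 + δ n) ^ (s / 2) / s ∂m)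
    (f' := fun n x => ∫ w, LL (gr s (δ n) (x - w)) ∂m)
    (g := fun x : 𝔼 => ∫ w, ‖x - w‖ ^ s / s ∂m)
    (g' := fun x => LL (∫ w, (‖x - w‖ ^ (s - 2)) • (x - w) ∂m))
    ?_ (fun n x => hasFDerivAt_reg_int h2 hs0 hs2 (hδ n) x)
    (fun x => tendsto_reg_int hd hC h h2 hs hs2 hδ hδ1 hδ0 x) x
  set b : ℕ → ℝ := fun n => C.toReal * (∫ v, (Metric.ball (0 : 𝔼) 1).indicator
      (fun v => ‖gr s (δ n) v - (‖v‖ ^ (s - 2)) • v‖) v) + (1 - s / 2) * δ n * m.real Set.univ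
    with hb
  have hb0 : Tendsto b atTop (𝓝 0) := by
    have := ((near_reg_tendsto hd hs hs2 hδ hδ0).const_mul C.toReal).add
      ((hδ0.const_mul (1 - s / 2)).mul_const (m.real Set.univ))
    simpa using this
  have key : ∀ n (x : 𝔼), ‖LL (∫ w, (‖x - w‖ ^ (s - 2)) • (x - w) ∂m)
      - ∫ w, LL (gr s (δ n) (x - w)) ∂m‖ ≤ b n := by
    intro n x
    have hi1 := integrable_rpow_smul_shift hd hC h h2 hs hs2 x
    have hi2 := integrable_gr_shift h2 hs2 (hδ n) x
    have hm : Measurable (fun w : 𝔼 => x - w) := measurable_const.sub measurable_id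
    rw [ContinuousLinearMap.integral_comp_comm _ hi2, ← map_sub, ← integral_sub hi1 hi2]
    refine (norm_LL_le _).trans ?_
    have hn1 : Integrable ((Metric.ball (0 : 𝔼) 1).indicator
        (fun v => ‖gr s (δ n) v - (‖v‖ ^ (s - 2)) • v‖)) volume := by
      refine (integrable_indicator_iff Metric.isOpen_ball.measurableSet).2
        (Integrable.mono' (integrableOn_norm_rpow hd (s := s - 1) (by linarith) 1) ?_
          (Eventually.of_forall fun v => ?_))
      · exact ((continuous_gr (hδ n)).measurable.sub
          ((measurable_norm.pow_const _).smul measurable_id)).norm.aestronglyMeasurable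
      · rw [norm_norm]; exact gr_diff_near hs2 (hδ n) v
    have hV1 := integrable_comp_of_map_le hm hC (map_sub_left_le h x) hn1
    have h5 : 0 ≤ (1 - s / 2) * δ n := mul_nonneg (by linarith) (hδ n).le
    refine (norm_integral_le_of_norm_le (hV1.add (integrable_const ((1 - s / 2) * δ n)))
      (Eventually.of_forall fun w => ?_)).trans ?_
    · rw [norm_sub_rev]
      simp only [Pi.add_apply]
      by_cases hv : x - w ∈ Metric.ball (0 : 𝔼) 1
      · rw [Set.indicator_of_mem hv]; linarith
      · rw [Set.indicator_of_notMem hv, zero_add]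
        rw [mem_ball_zero_iff, not_lt] at hv
        exact gr_diff_far hs2 (hδ n) hv
    · simp only [Pi.add_apply]
      rw [integral_add hV1 (integrable_const _), integral_const, smul_eq_mul,
        mul_comm (m.real Set.univ)]
      exact add_le_add (integral_comp_le_of_map_le hm hC (map_sub_left_le h x) hn1
        fun _ => Set.indicator_nonneg (fun _ _ => norm_nonneg _) _) le_rfl
  rw [Metric.tendstoUniformly_iff]
  intro ε hε
  filter_upwards [hb0.eventually (gt_mem_nhds hε)] with n hn x
  rw [dist_eq_norm]
  exact (key n x).trans_lt hn

lemma gradient_conv (hd : 1 ≤ d) {m : Measure 𝔼} [IsFiniteMeasure m] {C : ℝ≥0∞}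
    (hC : C ≠ ⊤) (h : m ≤ C • volume) (h2 : Integrable (fun w => ‖w‖ ^ 2) m) {p q : ℝ}
    (hp1 : 2 - (d : ℝ) ≤ p) (hp2 : p < 0) (hq1 : 0 < q) (hq2 : q ≤ 2) (x : 𝔼) :
    gradient (fun x : 𝔼 => ∫ w, Kfun d p q (x - w) ∂m) x = ∫ w, gradK d p q (x - w) ∂m := by
  have hq' : 2 - (d : ℝ) ≤ q := by linarith
  have hp' : p ≤ 2 := by linarith
  have e : (fun x : 𝔼 => ∫ w, Kfun d p q (x - w) ∂m)
      = fun x => (∫ w, ‖x - w‖ ^ q / q ∂m) - ∫ w, ‖x - w‖ ^ p / p ∂m := by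
    funext x
    exact integral_sub
      ((integrable_rpow_shift hd hC h h2 (t := q) (by linarith) hq2 x).div_const q)
      ((integrable_rpow_shift hd hC h h2 (t := p) (by linarith) hp' x).div_const p)
  have e2 : ∫ w, gradK d p q (x - w) ∂m = (∫ w, (‖x - w‖ ^ (q - 2)) • (x - w) ∂m)
      - ∫ w, (‖x - w‖ ^ (p - 2)) • (x - w) ∂m :=
    integral_sub (integrable_rpow_smul_shift hd hC h h2 hq' hq2 x)
      (integrable_rpow_smul_shift hd hC h h2 hp1 hp' x)
  rw [e, e2]
  have hfd := (hasFDerivAt_power hd hC h h2 hq' hq2 hq1.ne' x).sub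
    (hasFDerivAt_power hd hC h h2 hp1 hp' hp2.ne x)
  refine HasGradientAt.gradient ?_
  rw [hasGradientAt_iff_hasFDerivAt]
  refine hfd.congr_fderiv ?_
  ext u
  rw [← map_sub, LL_apply, InnerProductSpace.toDual_apply_apply]

end grad

section moll
variable {d : ℕ}

local notation "𝔼" => EuclideanSpace ℝ (Fin d)

lemma conv_le {a b : Measure 𝔼} [IsProbabilityMeasure a] [IsProbabilityMeasure b] {C : ℝ≥0∞}
    (h : b ≤ C • volume) : a ∗ b ≤ C • volume := by
  refine Measure.le_iff.2 fun s hs => ?_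
  rw [← lintegral_indicator_one hs, Measure.lintegral_conv (measurable_one.indicator hs)]
  calc _ ≤ ∫⁻ x : 𝔼, C * volume s ∂a := by
        refine lintegral_mono fun x => ?_
        refine (lintegral_mono' h le_rfl).trans ?_
        rw [lintegral_smul_measure, smul_eq_mul,
          lintegral_add_left_eq_self (fun y => s.indicator (1 : 𝔼 → ℝ≥0∞) y) x,
          lintegral_indicator_one hs]
    _ = _ := by simp

lemma prod_map_le {Ω : Type*} [MeasurableSpace Ω] {a : Measure 𝔼} [IsProbabilityMeasure a]
    {b : Measure Ω} [IsProbabilityMeasure b] {C : ℝ≥0∞} (h : a ≤ C • volume)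
    {T : Ω → 𝔼} (hT : Measurable T) :
    (a.prod b).map (fun z : 𝔼 × Ω => z.1 - T z.2) ≤ C • volume := by
  have hV : Measurable (fun z : 𝔼 × Ω => z.1 - T z.2) :=
    measurable_fst.sub (hT.comp measurable_snd)
  refine Measure.le_iff.2 fun s hs => ?_
  rw [Measure.map_apply hV hs, Measure.prod_apply_symm (hV hs)]
  calc _ ≤ ∫⁻ x : Ω, C * volume s ∂b := by
        refine lintegral_mono fun t => ?_
        refine (h _).trans ?_
        rw [Measure.smul_apply, smul_eq_mul]
        have : (fun x : 𝔼 => (x, t)) ⁻¹' ((fun z : 𝔼 × Ω => z.1 - T z.2) ⁻¹' s)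
            = (fun x => x - T t) ⁻¹' s := rfl
        rw [this, (measurePreserving_sub_right volume (T t)).measure_preimage hs.nullMeasurableSet]
    _ = _ := by simp

lemma HasBddDensity.le {μ : Measure 𝔼} {R : ℝ} (h : HasBddDensity d μ R) :
    μ ≤ ENNReal.ofReal R • volume := by
  obtain ⟨ρ, _, rfl, hR⟩ := h
  rw [← withDensity_const]
  exact withDensity_mono hR

lemma moll_bound {φ : 𝔼 → ℝ} (hφ : IsMollifier d φ) : ∃ B, ∀ x, φ x ≤ B := by
  obtain ⟨hs, _, h0, _, C, hC, l, hl, hdec⟩ := hφ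
  obtain ⟨B, hB⟩ := (isCompact_closedBall (0 : 𝔼) 1).exists_bound_of_continuousOn
    hs.continuous.continuousOn
  refine ⟨max B C, fun x => ?_⟩
  by_cases hx : x ∈ Metric.closedBall (0 : 𝔼) 1
  · exact (le_abs_self _).trans ((hB x hx).trans (le_max_left _ _))
  · rw [mem_closedBall_zero_iff, not_le] at hx
    have hx0 : x ≠ 0 := norm_pos_iff.1 (one_pos.trans hx)
    refine (hdec x hx0).trans (le_trans ?_ (le_max_right _ _))
    have h4 : (4 : ℝ) ≤ l := (le_max_right _ _).trans hl
    have : ‖x‖ ^ (-l) ≤ 1 := Real.rpow_le_one_of_one_le_of_nonpos hx.le (by linarith)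
    nlinarith

lemma moll_sq_integrable (hd : 3 ≤ d) {φ : 𝔼 → ℝ} (hφ : IsMollifier d φ) :
    Integrable (fun x => φ x * ‖x‖ ^ 2) := by
  obtain ⟨B, hB⟩ := moll_bound hφ
  obtain ⟨hs, _, h0, _, C, hC, l, hl, hdec⟩ := hφ
  have hd' : (3 : ℝ) ≤ d := by exact_mod_cast hd
  have hl1 : 2 * (d : ℝ) + 1 ≤ l := (le_max_left _ _).trans hl
  have hB0 : 0 ≤ B := (h0 0).trans (hB 0)
  set r : ℝ := 2 * d - 1
  have hr : (Module.finrank ℝ 𝔼 : ℝ) < r := by simp [r]; linarith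
  refine ((integrable_one_add_norm (μ := (volume : Measure 𝔼)) hr).const_mul
    ((B + C) * 2 ^ r)).mono' (hs.continuous.mul (by fun_prop)).aestronglyMeasurable
    (Eventually.of_forall fun x => ?_)
  rw [Real.norm_of_nonneg (mul_nonneg (h0 x) (by positivity))]
  have hr0 : 0 ≤ r := by simp only [r]; linarith
  have hpos : 0 < 1 + ‖x‖ := by positivity
  have e : 2 ^ r * (1 + ‖x‖) ^ (-r) = ((1 + ‖x‖) / 2) ^ (-r) := by
    rw [Real.div_rpow hpos.le (by norm_num), Real.rpow_neg (by norm_num : (0 : ℝ) ≤ 2)]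
    field_simp
  rw [mul_assoc, e]
  rcases le_total ‖x‖ 1 with hx | hx
  · have h1 : 1 ≤ ((1 + ‖x‖) / 2) ^ (-r) :=
      Real.one_le_rpow_of_pos_of_le_one_of_nonpos (by positivity) (by linarith) (by linarith)
    have h2 : ‖x‖ ^ 2 ≤ 1 := pow_le_one₀ (norm_nonneg _) hx
    calc φ x * ‖x‖ ^ 2 ≤ B * 1 := mul_le_mul (hB x) h2 (by positivity) hB0
      _ ≤ (B + C) * 1 := by linarith
      _ ≤ _ := by gcongr
  · have hx' : 0 < ‖x‖ := by linarith
    have h1 : ‖x‖ ^ (-r) ≤ ((1 + ‖x‖) / 2) ^ (-r) :=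
      Real.rpow_le_rpow_of_nonpos (by positivity) (by linarith) (by linarith)
    have h2 : ‖x‖ ^ (-l) * ‖x‖ ^ 2 ≤ ‖x‖ ^ (-r) := by
      rw [← Real.rpow_two, ← Real.rpow_add hx']
      exact Real.rpow_le_rpow_of_exponent_le hx (by simp only [r]; linarith)
    calc φ x * ‖x‖ ^ 2 ≤ (C * ‖x‖ ^ (-l)) * ‖x‖ ^ 2 := by
          gcongr; exact hdec x (norm_pos_iff.1 hx')
      _ = C * (‖x‖ ^ (-l) * ‖x‖ ^ 2) := by ring
      _ ≤ C * ((1 + ‖x‖) / 2) ^ (-r) := by gcongr; exact h2.trans h1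
      _ ≤ _ := by gcongr; linarith

/-- The probability measure with density `φ`. -/
def nu1 (φ : 𝔼 → ℝ) : Measure 𝔼 := volume.withDensity fun x => ENNReal.ofReal (φ x)

lemma nu1_prob {φ : 𝔼 → ℝ} (hφ : IsMollifier d φ) : IsProbabilityMeasure (nu1 φ) := by
  obtain ⟨_, _, h0, h1, _⟩ := hφ
  have hi : Integrable φ := by
    by_contra hc
    rw [integral_undef hc] at h1; norm_num at h1
  constructor
  rw [nu1, withDensity_apply _ MeasurableSet.univ, Measure.restrict_univ,
    ← ofReal_integral_eq_lintegral_ofReal hi (Eventually.of_forall h0), h1, ENNReal.ofReal_one]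

lemma nu1_le {φ : 𝔼 → ℝ} (hφ : IsMollifier d φ) :
    ∃ C : ℝ≥0∞, C ≠ ⊤ ∧ nu1 φ ≤ C • volume := by
  obtain ⟨B, hB⟩ := moll_bound hφ
  refine ⟨ENNReal.ofReal B, ENNReal.ofReal_ne_top, ?_⟩
  rw [← withDensity_const]
  exact withDensity_mono (Eventually.of_forall fun x => ENNReal.ofReal_le_ofReal (hB x))

lemma nu1_sq (hd : 3 ≤ d) {φ : 𝔼 → ℝ} (hφ : IsMollifier d φ) :
    Integrable (fun x => ‖x‖ ^ 2) (nu1 φ) := by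
  have hm : Measurable φ := hφ.1.continuous.measurable
  rw [nu1, integrable_withDensity_iff_integrable_smul' hm.ennreal_ofReal
    (Eventually.of_forall fun _ => ENNReal.ofReal_lt_top)]
  simpa [ENNReal.toReal_ofReal (hφ.2.2.1 _)] using moll_sq_integrable hd hφ

lemma integral_scaled {φ : 𝔼 → ℝ} (hφ : IsMollifier d φ) {ε : ℝ} (hε : 0 < ε) (h : 𝔼 → ℝ) :
    ∫ y, scaled d φ ε y * h y = ∫ y, h (ε • y) ∂(nu1 φ) := by
  have hm : Measurable φ := hφ.1.continuous.measurable
  rw [nu1, integral_withDensity_eq_integral_toReal_smul hm.ennreal_ofReal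
    (Eventually.of_forall fun _ => ENNReal.ofReal_lt_top)]
  simp only [ENNReal.toReal_ofReal (hφ.2.2.1 _), smul_eq_mul]
  have := Measure.integral_comp_inv_smul_of_nonneg (volume : Measure 𝔼)
    (fun y => φ y * h (ε • y)) hε.le
  simp only [smul_inv_smul₀ hε.ne', finrank_euclideanSpace, Fintype.card_fin, smul_eq_mul] at this
  simp only [scaled, mul_assoc]
  rw [integral_const_mul, this, inv_mul_cancel_left₀ (by positivity)]

lemma conv_sq {a b : Measure 𝔼} [IsProbabilityMeasure a] [IsProbabilityMeasure b]
    (ha : Integrable (fun x => ‖x‖ ^ 2) a) (hb : Integrable (fun x => ‖x‖ ^ 2) b) :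
    Integrable (fun x => ‖x‖ ^ 2) (a ∗ b) := by
  have h1 : Integrable (fun z : 𝔼 × 𝔼 => ‖z.1‖ ^ 2) (a.prod b) := ha.comp_fst b
  have h2 : Integrable (fun z : 𝔼 × 𝔼 => ‖z.2‖ ^ 2) (a.prod b) := hb.comp_snd a
  rw [Measure.conv, integrable_map_measure (by fun_prop) (by fun_prop)]
  refine ((h1.const_mul 2).add (h2.const_mul 2)).mono' (by fun_prop)
    (Eventually.of_forall fun z => ?_)
  simp only [Function.comp, Pi.add_apply]
  rw [Real.norm_of_nonneg (by positivity)]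
  have := norm_add_le z.1 z.2
  have h0 := norm_nonneg (z.1 + z.2)
  nlinarith [sq_nonneg (‖z.1‖ - ‖z.2‖)]

lemma scale_props {M : Measure 𝔼} [IsProbabilityMeasure M] {C : ℝ≥0∞} (hC : C ≠ ⊤)
    (h : M ≤ C • volume) (h2 : Integrable (fun x => ‖x‖ ^ 2) M) {ε : ℝ} (hε : 0 < ε) :
    IsProbabilityMeasure (M.map (fun x => ε • x)) ∧
    (∃ C' : ℝ≥0∞, C' ≠ ⊤ ∧ M.map (fun x => ε • x) ≤ C' • volume) ∧
    Integrable (fun x => ‖x‖ ^ 2) (M.map (fun x => ε • x)) := by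
  have hm : Measurable (fun x : 𝔼 => ε • x) := measurable_const_smul ε
  refine ⟨Measure.isProbabilityMeasure_map hm.aemeasurable,
    ⟨C * ENNReal.ofReal |(ε ^ Module.finrank ℝ 𝔼)⁻¹|, ENNReal.mul_ne_top hC
      ENNReal.ofReal_ne_top, ?_⟩, ?_⟩
  · refine (Measure.map_mono h hm).trans ?_
    rw [Measure.map_smul, Measure.map_addHaar_smul volume hε.ne', smul_smul]
  · rw [integrable_map_measure (by fun_prop) (by fun_prop)]
    refine (h2.const_mul (ε ^ 2)).congr (Eventually.of_forall fun x => ?_)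
    simp [norm_smul, mul_pow]

lemma integrable_Kfun (hd : 1 ≤ d) {m : Measure 𝔼} [IsFiniteMeasure m] {C : ℝ≥0∞}
    (hC : C ≠ ⊤) (h : m ≤ C • volume) (h2 : Integrable (fun w => ‖w‖ ^ 2) m) {p q : ℝ}
    (hp1 : 2 - (d : ℝ) ≤ p) (hp2 : p < 0) (hq1 : 0 < q) (hq2 : q ≤ 2) (x : 𝔼) :
    Integrable (fun w => Kfun d p q (x - w)) m := by
  have hd0 : (0 : ℝ) ≤ d := Nat.cast_nonneg d
  exact ((integrable_rpow_shift hd hC h h2 (t := q) (by linarith) hq2 x).div_const q).sub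
    ((integrable_rpow_shift hd hC h h2 (t := p) (by linarith) (by linarith) x).div_const p)

lemma Kreg_eq (hd : 3 ≤ d) {φ : 𝔼 → ℝ} (hφ : IsMollifier d φ) {p q : ℝ}
    (hp1 : 2 - (d : ℝ) ≤ p) (hp2 : p < 0) (hq1 : 0 < q) (hq2 : q ≤ 2) {ε : ℝ} (hε : 0 < ε)
    (x : 𝔼) :
    Kreg d p q φ ε x = ∫ w, Kfun d p q (x - w) ∂((nu1 φ ∗ nu1 φ).map (fun w => ε • w)) := by
  have := nu1_prob hφ
  obtain ⟨C, hC, hle⟩ := nu1_le hφ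
  have hsq := nu1_sq hd hφ
  obtain ⟨hP, ⟨C', hC', hle'⟩, hsq'⟩ := scale_props hC (conv_le (a := nu1 φ) hle)
    (conv_sq hsq hsq) hε
  have hi := integrable_Kfun (by omega) hC' hle' hsq' hp1 hp2 hq1 hq2 x
  have hm : Measurable (fun x : 𝔼 => ε • x) := measurable_const_smul ε
  rw [integral_map hm.aemeasurable hi.aestronglyMeasurable]
  have hi' : Integrable (fun w => Kfun d p q (x - ε • w)) (nu1 φ ∗ nu1 φ) :=
    hi.comp_measurable hm
  rw [integral_conv hi']
  unfold Kreg
  simp only [mul_assoc, integral_const_mul]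
  rw [integral_scaled hφ hε (fun y => ∫ z, Kfun d p q (x - y - z) * scaled d φ ε z)]
  refine integral_congr_ae (Eventually.of_forall fun y => ?_)
  simp only [mul_comm _ (scaled d φ ε _)]
  rw [integral_scaled hφ hε (fun z => Kfun d p q (x - ε • y - z))]
  simp [smul_add, sub_sub]

end moll

section final
variable {d : ℕ}

local notation "𝔼" => EuclideanSpace ℝ (Fin d)

lemma tendsto_of_weakStar {μ : ℕ → Measure 𝔼} {ν : Measure 𝔼}
    {P : ℕ → ProbabilityMeasure 𝔼} {P' : ProbabilityMeasure 𝔼}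
    (hP : ∀ k, (P k : Measure 𝔼) = μ k) (hP' : (P' : Measure 𝔼) = ν)
    (h : WeakStarTendsto d μ ν) : Tendsto P atTop (𝓝 P') := by
  rw [ProbabilityMeasure.tendsto_iff_forall_integral_tendsto]
  intro g
  simp only [hP, hP']
  exact h g g.continuous ⟨‖g‖, fun x => g.norm_coe_le_norm x⟩

lemma tendsto_scaled {M : Measure 𝔼} [IsProbabilityMeasure M] {ε : ℕ → ℝ}
    (hε : Tendsto ε atTop (𝓝 0)) {P : ℕ → ProbabilityMeasure 𝔼} {P' : ProbabilityMeasure 𝔼}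
    (hP : ∀ k, (P k : Measure 𝔼) = M.map (fun w => ε k • w))
    (hP' : (P' : Measure 𝔼) = Measure.dirac 0) : Tendsto P atTop (𝓝 P') := by
  rw [ProbabilityMeasure.tendsto_iff_forall_integral_tendsto]
  intro g
  have e : ∀ k, ∫ w, g w ∂(M.map (fun w => ε k • w)) = ∫ w, g (ε k • w) ∂M := fun k =>
    integral_map (measurable_const_smul (ε k)).aemeasurable g.continuous.aestronglyMeasurable
  have l : ∫ w, g w ∂(Measure.dirac (0 : 𝔼)) = ∫ w, g 0 ∂M := by simp
  simp only [hP, hP', e, l]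
  refine tendsto_integral_of_dominated_convergence (fun _ => ‖g‖) (fun k => ?_)
    (integrable_const _) (fun k => Eventually.of_forall fun w => g.norm_coe_le_norm _)
    (Eventually.of_forall fun w => ?_)
  · exact (g.continuous.comp (continuous_const_smul (ε k))).aestronglyMeasurable
  · have : Tendsto (fun k => ε k • w) atTop (𝓝 0) := by
      simpa using hε.smul_const w
    exact (g.continuous.tendsto 0).comp this

lemma moment_bound (hd : 3 ≤ d) {φ : 𝔼 → ℝ} (hφ : IsMollifier d φ) {p q : ℝ}
    (hp1 : 2 - (d : ℝ) ≤ p) (hp2 : p < 0) (hq1 : 0 < q) (hq2 : q ≤ 2) {ε : ℝ} (hε : 0 < ε)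
    (μ : Measure 𝔼) [IsProbabilityMeasure μ] :
    ∫⁻ z : 𝔼 × (𝔼 × 𝔼), ENNReal.ofReal (‖z.1 - (z.2.1 + z.2.2)‖ ^ q)
      ∂(μ.prod (μ.prod ((nu1 φ ∗ nu1 φ).map (fun w => ε • w))))
      ≤ ENNReal.ofReal q * energyReg d p q φ ε μ := by
  have := nu1_prob hφ
  obtain ⟨C, hC, hle⟩ := nu1_le hφ
  have hsq := nu1_sq hd hφ
  obtain ⟨hP, ⟨C', hC', hle'⟩, hsq'⟩ := scale_props hC (conv_le (a := nu1 φ) hle)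
    (conv_sq hsq hsq) hε
  have hd0 : (0 : ℝ) ≤ d := Nat.cast_nonneg d
  have hmeas : Measurable (fun z : 𝔼 × (𝔼 × 𝔼) =>
      ENNReal.ofReal (‖z.1 - (z.2.1 + z.2.2)‖ ^ q)) := by fun_prop
  have hpt : ∀ v : 𝔼, ∫⁻ w, ENNReal.ofReal (‖v - w‖ ^ q)
      ∂((nu1 φ ∗ nu1 φ).map (fun w => ε • w))
      ≤ ENNReal.ofReal q * ENNReal.ofReal (Kreg d p q φ ε v) := by
    intro v
    have hi := integrable_rpow_shift (by omega) hC' hle' hsq' (t := q) (by linarith) hq2 v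
    have hK := integrable_Kfun (by omega) hC' hle' hsq' hp1 hp2 hq1 hq2 v
    rw [← ofReal_integral_eq_lintegral_ofReal hi (Eventually.of_forall fun w => by positivity),
      ← ENNReal.ofReal_mul hq1.le, Kreg_eq hd hφ hp1 hp2 hq1 hq2 hε, ← integral_const_mul]
    refine ENNReal.ofReal_le_ofReal (integral_mono hi (hK.const_mul q) fun w => ?_)
    have h1 : ‖v - w‖ ^ p / p ≤ 0 := div_nonpos_of_nonneg_of_nonpos (by positivity) hp2.le
    have h2 : q * (‖v - w‖ ^ q / q) = ‖v - w‖ ^ q := by field_simp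
    simp only [Kfun]
    nlinarith
  rw [lintegral_prod _ hmeas.aemeasurable, energyReg, energyE]
  rw [← lintegral_const_mul' _ _ ENNReal.ofReal_ne_top]
  refine lintegral_mono fun x => ?_
  have hmx : Measurable (fun y : 𝔼 × 𝔼 => ENNReal.ofReal (‖x - (y.1 + y.2)‖ ^ q)) := by fun_prop
  rw [lintegral_prod (fun y : 𝔼 × 𝔼 => ENNReal.ofReal (‖x - (y.1 + y.2)‖ ^ q)) hmx.aemeasurable,
    ← lintegral_const_mul' _ _ ENNReal.ofReal_ne_top]
  refine lintegral_mono fun y => ?_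
  simpa only [sub_sub] using hpt (x - y)

lemma fubini_fg {a b c : Measure 𝔼} [SFinite a] [SFinite b] [SFinite c] {f : 𝔼 → ℝ} {p q : ℝ}
    (h : Integrable (fun z : 𝔼 × (𝔼 × 𝔼) => f z.1 • gradK d p q (z.1 - (z.2.1 + z.2.2)))
      (a.prod (b.prod c))) :
    ∫ z, f z.1 • gradK d p q (z.1 - (z.2.1 + z.2.2)) ∂(a.prod (b.prod c))
      = ∫ x, f x • ∫ y, ∫ w, gradK d p q (x - y - w) ∂c ∂b ∂a := by
  rw [integral_prod _ h]
  refine integral_congr_ae ?_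
  filter_upwards [h.prod_right_ae] with x hx
  rw [integral_prod _ hx]
  simp only [integral_smul, sub_sub]

end final

end NLT

/-- Convergence of the nonlinear term: for bounded-density measures with
uniformly bounded regularized energies converging weakly-* to a bounded-density measure,
`∫ f (∇K_{ε_k} * μ_k) dμ_k → ∫ f (∇K * μ) dμ` for every test function `f ∈ C_c^∞`. -/
theorem nonlinear_term_convergence
    (d : ℕ) (hd : 3 ≤ d) (p q : ℝ) (hp1 : 2 - (d : ℝ) ≤ p) (hp2 : p < 0)
    (hq1 : 0 < q) (hq2 : q ≤ 2)
    (R : ℝ) (hR : 0 < R)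
    (φ : EuclideanSpace ℝ (Fin d) → ℝ) (hφ : IsMollifier d φ)
    (ε : ℕ → ℝ) (hεpos : ∀ k, 0 < ε k) (hε0 : Tendsto ε atTop (𝓝 0))
    (μ : ℕ → Measure (EuclideanSpace ℝ (Fin d))) (hprob : ∀ k, IsProbabilityMeasure (μ k))
    (hbdd : ∀ k, HasBddDensity d (μ k) R)
    (henergy : (⨆ k, energyReg d p q φ (ε k) (μ k)) < ⊤)
    (ν : Measure (EuclideanSpace ℝ (Fin d))) (hν : IsProbabilityMeasure ν)
    (hνbdd : HasBddDensity d ν R)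
    (hconv : WeakStarTendsto d μ ν) :
    ∀ f : EuclideanSpace ℝ (Fin d) → ℝ, ContDiff ℝ (⊤ : ℕ∞) f → HasCompactSupport f →
      Tendsto
        (fun k => ∫ x, f x • (∫ y, gradient (Kreg d p q φ (ε k)) (x - y) ∂(μ k)) ∂(μ k))
        atTop (𝓝 (∫ x, f x • (∫ y, gradK d p q (x - y) ∂ν) ∂ν)) := by
  intro f hf hfc
  have hd1 : 1 ≤ d := by omega
  have hn := NLT.nu1_prob hφ
  obtain ⟨C, hC, hle⟩ := NLT.nu1_le hφ
  have hsq := NLT.nu1_sq hd hφ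
  have hcle := NLT.conv_le (a := NLT.nu1 φ) hle
  have hcsq := NLT.conv_sq hsq hsq
  have hP : ∀ k, IsProbabilityMeasure ((NLT.nu1 φ ∗ NLT.nu1 φ).map (fun w => ε k • w)) :=
    fun k => (NLT.scale_props hC hcle hcsq (hεpos k)).1
  obtain ⟨M, hM⟩ := hfc.exists_bound_of_continuous hf.continuous
  have hM0 : 0 ≤ M := (norm_nonneg _).trans (hM 0)
  let μ' : ℕ → ProbabilityMeasure (EuclideanSpace ℝ (Fin d)) := fun k => ⟨μ k, hprob k⟩
  let ν' : ProbabilityMeasure (EuclideanSpace ℝ (Fin d)) := ⟨ν, hν⟩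
  let m : ℕ → ProbabilityMeasure (EuclideanSpace ℝ (Fin d)) := fun k => ⟨_, hP k⟩
  let m' : ProbabilityMeasure (EuclideanSpace ℝ (Fin d)) := ⟨Measure.dirac 0, inferInstance⟩
  have hμ' : Tendsto μ' atTop (𝓝 ν') := NLT.tendsto_of_weakStar (fun _ => rfl) rfl hconv
  have hm' : Tendsto m atTop (𝓝 m') := NLT.tendsto_scaled hε0 (fun _ => rfl) rfl
  have hπ : Tendsto (fun k => (μ' k).prod ((μ' k).prod (m k))) atTop
      (𝓝 (ν'.prod (ν'.prod m'))) := by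
    have h1 := (ProbabilityMeasure.continuous_prod.tendsto (ν', m')).comp (hμ'.prodMk_nhds hm')
    exact (ProbabilityMeasure.continuous_prod.tendsto (ν', ν'.prod m')).comp
      (hμ'.prodMk_nhds h1)
  have hR1 : ENNReal.ofReal R ≠ ⊤ := ENNReal.ofReal_ne_top
  have hT : Measurable (fun z : EuclideanSpace ℝ (Fin d) × EuclideanSpace ℝ (Fin d) =>
    z.1 + z.2) := measurable_fst.add measurable_snd
  have hD : ENNReal.ofReal q * (⨆ k, energyReg d p q φ (ε k) (μ k)) ≠ ⊤ :=
    ENNReal.mul_ne_top ENNReal.ofReal_ne_top henergy.ne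
  have hmap : ∀ k, (((μ' k).prod ((μ' k).prod (m k)) : ProbabilityMeasure (EuclideanSpace ℝ (Fin d) × (EuclideanSpace ℝ (Fin d) ×
      EuclideanSpace ℝ (Fin d)))) : Measure _).map
      (fun z : EuclideanSpace ℝ (Fin d) × (EuclideanSpace ℝ (Fin d) ×
        EuclideanSpace ℝ (Fin d)) => z.1 - (z.2.1 + z.2.2)) ≤ ENNReal.ofReal R • volume :=
    fun k => NLT.prod_map_le (NLT.HasBddDensity.le (hbdd k)) hT
  have hmom : ∀ k, ∫⁻ z : EuclideanSpace ℝ (Fin d) × (EuclideanSpace ℝ (Fin d) ×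
      EuclideanSpace ℝ (Fin d)), ENNReal.ofReal (‖z.1 - (z.2.1 + z.2.2)‖ ^ q)
      ∂(((μ' k).prod ((μ' k).prod (m k)) : ProbabilityMeasure _) : Measure _)
      ≤ ENNReal.ofReal q * (⨆ k, energyReg d p q φ (ε k) (μ k)) := fun k =>
    (NLT.moment_bound hd hφ hp1 hp2 hq1 hq2 (hεpos k) (μ k)).trans
      (mul_le_mul_right (le_iSup (fun k => energyReg d p q φ (ε k) (μ k)) k) _)
  have hV : Continuous (fun z : EuclideanSpace ℝ (Fin d) × (EuclideanSpace ℝ (Fin d) ×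
    EuclideanSpace ℝ (Fin d)) => z.1 - (z.2.1 + z.2.2)) := by fun_prop
  have hF : Continuous (fun z : EuclideanSpace ℝ (Fin d) × (EuclideanSpace ℝ (Fin d) ×
    EuclideanSpace ℝ (Fin d)) => f z.1) := hf.continuous.comp continuous_fst
  have key := NLT.core_tendsto hd1 hp1 (by linarith) hq1.le hπ hV hF (fun z => hM z.1) hM0 hR1
    hmap (NLT.prod_map_le (NLT.HasBddDensity.le hνbdd) hT) hD hmom
  have hlim := NLT.fubini_fg (a := ν) (b := ν) (c := Measure.dirac 0) key.1
  have hk : ∀ k, _ = _ := fun k => NLT.fubini_fg (a := μ k) (b := μ k)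
    (c := (NLT.nu1 φ ∗ NLT.nu1 φ).map (fun w => ε k • w))
    (NLT.integrable_fg (π := ((μ' k).prod ((μ' k).prod (m k)) : ProbabilityMeasure _))
      hd1 hp1 (by linarith) hV hF (fun z => hM z.1) hR1 (hmap k) hD (hmom k))
  have hgrad : ∀ k v, gradient (Kreg d p q φ (ε k)) v
      = ∫ w, gradK d p q (v - w) ∂((NLT.nu1 φ ∗ NLT.nu1 φ).map (fun w => ε k • w)) := by
    intro k v
    obtain ⟨_, ⟨C', hC', hle'⟩, hsq'⟩ := NLT.scale_props hC hcle hcsq (hεpos k)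
    rw [← NLT.gradient_conv hd1 hC' hle' hsq' hp1 hp2 hq1 hq2 v]
    congr 1
    funext x
    exact NLT.Kreg_eq hd hφ hp1 hp2 hq1 hq2 (hεpos k) x
  have key2 := key.2
  simp only [hgrad]
  simp only [integral_dirac, sub_zero] at hlim
  rw [← hlim]
  refine key2.congr fun k => ?_
  exact hk k
end
end
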